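/- arXiv:2402.16588 — 5 statements merged into one kernel-verified Lean document; each statement's English description precedes it below -/
import Mathlib

section
/- Let d ≥ 1 be an integer, ε ∈ [0,1), and P(x) = x^d + p_{d-1}x^{d-1} + … + p_1 x + p_0 ∈ ℤ[x] with |p_0| ≥ 2. Then P is an ε-CNS polynomial if and only if the vector (1/p_0, p_{d-1}/p_0, …, p_1/p_0) belongs to D⁰_{d,ε}. -/
open Polynomial

/-- `P` is an `ε`-CNS polynomial: every integer polynomial `a` is congruent modulo `P`
to a sum `∑ d_j x^j` whose digits `d_j` lie in `N_ε = [-ε|P(0)|, (1-ε)|P(0)|) ∩ ℤ`. -/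
def IsEpsCNS (ε : ℝ) (P : Polynomial ℤ) : Prop :=
  ∀ a : Polynomial ℤ, ∃ l : ℕ, 0 < l ∧ ∃ dig : ℕ → ℤ,
    (∀ j < l, -(ε * |(P.coeff 0 : ℝ)|) ≤ (dig j : ℝ) ∧
        (dig j : ℝ) < (1 - ε) * |(P.coeff 0 : ℝ)|) ∧
    P ∣ a - ∑ j ∈ Finset.range l, C (dig j) * X ^ j

/-- The map `τ_{r,ε}(z_1,…,z_d) = (z_2,…,z_d, -⌊r·z + ε⌋)`. -/
noncomputable def tauEps (d : ℕ) (r : Fin d → ℝ) (ε : ℝ) (z : Fin d → ℤ) :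
    Fin d → ℤ :=
  fun i => if h : (i : ℕ) + 1 < d then z ⟨(i : ℕ) + 1, h⟩
    else -⌊(∑ j, r j * (z j : ℝ)) + ε⌋

/-- `D⁰_{d,ε}`: the set of `r` such that every orbit of `τ_{r,ε}` reaches `0`. -/
def SRSset (d : ℕ) (ε : ℝ) : Set (Fin d → ℝ) :=
  {r | ∀ z : Fin d → ℤ, ∃ k : ℕ, (tauEps d r ε)^[k] z = 0}

namespace EpsCNS

/-- The auxiliary basis. -/
noncomputable def W (d : ℕ) (p : ℕ → ℤ) : ℕ → Polynomial ℤ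
  | 0 => 1
  | j + 1 => X * W d p j + C (p (d - 1 - j))

lemma W_eq (d : ℕ) (p : ℕ → ℤ) (j : ℕ) (hj : j ≤ d) :
    W d p j = X ^ j + ∑ i ∈ Finset.range j, C (p (d - j + i)) * X ^ i := by
  induction j with
  | zero => simp [W]
  | succ j ih =>
    rw [W, ih (by omega), Finset.sum_range_succ', mul_add, Finset.mul_sum]
    have : ∀ i, d - (j + 1) + (i + 1) = d - j + i := by intro i; omega
    simp only [this]
    have h2 : d - (j + 1) + 0 = d - 1 - j := by omega
    rw [h2]
    have : ∑ i ∈ Finset.range j, X * (C (p (d - j + i)) * X ^ i)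
      = ∑ i ∈ Finset.range j, C (p (d - j + i)) * X ^ (i + 1) :=
      Finset.sum_congr rfl (fun i _ => by ring)
    rw [this]; ring

lemma W_coeff (d : ℕ) (p : ℕ → ℤ) (j : ℕ) :
    (W d p j).coeff j = 1 ∧ ∀ n, j < n → (W d p j).coeff n = 0 := by
  induction j with
  | zero =>
    refine ⟨by simp [W], fun n hn => ?_⟩
    simp [W, coeff_one]; omega
  | succ j ih =>
    refine ⟨by rw [W, coeff_add, coeff_X_mul, coeff_C, ih.1]; simp, fun n hn => ?_⟩
    obtain ⟨n, rfl⟩ : ∃ k, n = k + 1 := ⟨n - 1, by omega⟩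
    rw [W, coeff_add, coeff_X_mul, coeff_C, ih.2 n (by omega)]; simp

lemma sum_coeff (d : ℕ) (p : ℕ → ℤ) (z : ℕ → ℤ) (n k : ℕ) (hk : n ≤ k) :
    (∑ j ∈ Finset.range n, C (z j) * W d p j).coeff k = 0 := by
  rw [finsetSum_coeff]
  refine Finset.sum_eq_zero fun j hj => ?_
  rw [coeff_C_mul, (W_coeff d p j).2 k (by have := Finset.mem_range.1 hj; omega), mul_zero]

lemma surj (d : ℕ) (p : ℕ → ℤ) (n : ℕ) : ∀ a : Polynomial ℤ, (∀ k, n ≤ k → a.coeff k = 0) →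
    ∃ z : ℕ → ℤ, a = ∑ j ∈ Finset.range n, C (z j) * W d p j := by
  induction n with
  | zero => intro a ha; exact ⟨0, by ext k; simp [ha k]⟩
  | succ n ih =>
    intro a ha
    obtain ⟨z, hz⟩ := ih (a - C (a.coeff n) * W d p n) (by
      intro k hk
      rw [coeff_sub, coeff_C_mul]
      rcases hk.eq_or_lt with rfl | h
      · simp [(W_coeff d p n).1]
      · simp [(W_coeff d p n).2 k h, ha k h])
    refine ⟨fun j => if j = n then a.coeff n else z j, ?_⟩
    rw [Finset.sum_range_succ]
    have : ∑ j ∈ Finset.range n, C (if j = n then a.coeff n else z j) * W d p j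
        = ∑ j ∈ Finset.range n, C (z j) * W d p j :=
      Finset.sum_congr rfl fun j hj => by
        rw [if_neg (by have := Finset.mem_range.1 hj; omega)]
    rw [this, ← hz]; simp

lemma inj (d : ℕ) (p : ℕ → ℤ) (z : ℕ → ℤ) (n : ℕ)
    (h : ∑ j ∈ Finset.range n, C (z j) * W d p j = 0) : ∀ j < n, z j = 0 := by
  induction n with
  | zero => intro j hj; omega
  | succ n ih =>
    rw [Finset.sum_range_succ] at h
    have hn : z n = 0 := by
      have := congrArg (fun q => q.coeff n) h
      simp only [coeff_add, sum_coeff d p z n n le_rfl, coeff_C_mul,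
        (W_coeff d p n).1, coeff_zero] at this
      linarith
    rw [hn] at h
    intro j hj
    rcases (Nat.lt_succ_iff.1 hj).eq_or_lt with rfl | h'
    · exact hn
    · exact ih (by simpa using h) j h'

/-- The map from vectors to polynomials. -/
noncomputable def Phi (d : ℕ) (p : ℕ → ℤ) (z : Fin d → ℤ) : Polynomial ℤ :=
  ∑ j : Fin d, C (z j) * W d p j

lemma Phi_eq (d : ℕ) (p : ℕ → ℤ) (z : Fin d → ℤ) :
    Phi d p z = ∑ j ∈ Finset.range d,
      C ((fun j => if h : j < d then z ⟨j, h⟩ else 0) j) * W d p j := by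
  rw [Finset.sum_range, Phi]; simp

lemma W_monic (d : ℕ) (p : ℕ → ℤ) (j : ℕ) : (W d p j).natDegree = j ∧ (W d p j).Monic := by
  have h1 : (W d p j).natDegree = j := by
    apply le_antisymm
    · exact natDegree_le_iff_coeff_eq_zero.2 fun n hn => (W_coeff d p j).2 n hn
    · exact le_natDegree_of_ne_zero (by rw [(W_coeff d p j).1]; simp)
  refine ⟨h1, ?_⟩
  rw [Monic, leadingCoeff, h1, (W_coeff d p j).1]

lemma Phi_zero_of_dvd (d : ℕ) (p : ℕ → ℤ) (z : Fin d → ℤ) (h : W d p d ∣ Phi d p z) : z = 0 := by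
  have hdeg : (Phi d p z).degree < (W d p d).degree := by
    rw [degree_eq_natDegree (W_monic d p d).2.ne_zero, (W_monic d p d).1,
      degree_lt_iff_coeff_zero]
    intro k hk
    rw [Phi_eq, sum_coeff _ _ _ _ _ hk]
  have h0 := eq_zero_of_dvd_of_degree_lt h hdeg
  rw [Phi_eq] at h0
  have := inj d p _ d h0
  funext j
  simpa using this j j.2

lemma Phi_surj (d : ℕ) (p : ℕ → ℤ) (a : Polynomial ℤ) :
    ∃ z : Fin d → ℤ, W d p d ∣ a - Phi d p z := by
  obtain ⟨z, hz⟩ := surj d p d (a %ₘ W d p d) (by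
    intro k hk
    have := degree_modByMonic_lt a (W_monic d p d).2
    rw [degree_eq_natDegree (W_monic d p d).2.ne_zero, (W_monic d p d).1,
      degree_lt_iff_coeff_zero] at this
    exact this k hk)
  refine ⟨fun j => z j, ?_⟩
  have : Phi d p (fun j => z j) = a %ₘ W d p d := by
    rw [hz, Finset.sum_range, Phi]
  rw [this]
  exact ⟨a /ₘ W d p d, by
    have := modByMonic_add_div a (W d p d)
    linear_combination -this⟩

/-- The parameter vector. -/
noncomputable def rv (d : ℕ) (p : ℕ → ℤ) : Fin d → ℝ := fun i : Fin d =>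
          if (i : ℕ) = 0 then 1 / (p 0 : ℝ)
          else (p (d - (i : ℕ)) : ℝ) / (p 0 : ℝ)

/-- Unsigned digit set. -/
def IsDig (ε : ℝ) (c : ℤ) (x : ℤ) : Prop :=
  -(ε * |(c : ℝ)|) ≤ (x : ℝ) ∧ (x : ℝ) < (1 - ε) * |(c : ℝ)|

lemma dig_unique {ε : ℝ} {c x y : ℤ} (hx : IsDig ε c x) (hy : IsDig ε c y) (h : c ∣ x - y) :
    x = y := by
  have : |x - y| < |c| := by
    have : |((x:ℝ) - y)| < |(c:ℝ)| := by
      rw [abs_lt]; constructor <;> nlinarith [hx.1, hx.2, hy.1, hy.2]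
    exact_mod_cast this
  have := Int.eq_zero_of_abs_lt_dvd ((abs_dvd c _).2 h) this
  omega

lemma step (m : ℕ) (ε : ℝ) (p : ℕ → ℤ) (hp : 2 ≤ |p 0|) (s : ℤ)
    (hs : s = 1 ∧ 0 < p 0 ∨ s = -1 ∧ p 0 < 0) (z : Fin (m + 1) → ℤ) :
    ∃ δ : ℤ, IsDig ε (p 0) (s * δ) ∧ W (m+1) p (m+1) ∣
      Phi (m+1) p z - (C δ + X * Phi (m+1) p (tauEps (m+1) (rv (m+1) p) ε z)) := by
  set S : ℤ := z 0 + ∑ j : Fin m, p (m - j) * z j.succ with hS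
  set t : ℤ := -⌊(∑ j, rv (m+1) p j * (z j : ℝ)) + ε⌋ with ht
  have hp0 : (p 0 : ℝ) ≠ 0 := by
    have : p 0 ≠ 0 := by intro h; simp [h] at hp
    exact_mod_cast this
  have hsum : (∑ j, rv (m+1) p j * (z j : ℝ)) = S / p 0 := by
    rw [Fin.sum_univ_succ, hS]
    push_cast
    rw [add_div, Finset.sum_div]
    congr 1
    · simp [rv]; ring
    · refine Finset.sum_congr rfl fun j _ => ?_
      simp [rv]; ring
  refine ⟨S + t * p 0, ?_, ?_⟩
  · have h1 := Int.floor_le ((S : ℝ) / p 0 + ε)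
    have h2 := Int.lt_floor_add_one ((S : ℝ) / p 0 + ε)
    rw [hsum] at ht
    have ht' : ((⌊(S : ℝ) / p 0 + ε⌋ : ℤ) : ℝ) = -(t : ℝ) := by rw [ht]; push_cast; ring
    rw [ht'] at h1 h2
    have hq : (S : ℝ) = (S / p 0) * p 0 := by field_simp
    set q : ℝ := (S : ℝ) / p 0
    unfold IsDig
    push_cast
    rw [hq]
    rcases hs with ⟨rfl, h⟩ | ⟨rfl, h⟩
    · have h' : (0:ℝ) < p 0 := by exact_mod_cast h
      rw [abs_of_pos h']
      push_cast
      constructor <;> nlinarith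
    · have h' : (p 0 : ℝ) < 0 := by exact_mod_cast h
      rw [abs_of_neg h']
      push_cast
      constructor <;> nlinarith
  · refine ⟨-C t, ?_⟩
    have e1 : Phi (m+1) p z = C (z 0) + ∑ j : Fin m, C (z j.succ) * W (m+1) p (j+1) := by
      rw [Phi, Fin.sum_univ_succ]; simp [W]
    have e2 : Phi (m+1) p (tauEps (m+1) (rv (m+1) p) ε z)
        = ∑ j : Fin m, C (z j.succ) * W (m+1) p j + C t * W (m+1) p m := by
      rw [Phi, Fin.sum_univ_castSucc]
      congr 1
      · refine Finset.sum_congr rfl fun j _ => ?_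
        have : tauEps (m+1) (rv (m+1) p) ε z j.castSucc = z j.succ := by
          simp [tauEps]; rfl
        rw [this]; simp
      · have : tauEps (m+1) (rv (m+1) p) ε z (Fin.last m) = t := by
          simp [tauEps, ht]
        rw [this]; simp
    have e3 : ∑ j : Fin m, C (z j.succ) * W (m+1) p (j+1)
        = X * ∑ j : Fin m, C (z j.succ) * W (m+1) p j
          + ∑ j : Fin m, C (p (m - j) * z j.succ) := by
      rw [Finset.mul_sum, ← Finset.sum_add_distrib]
      refine Finset.sum_congr rfl fun j _ => ?_
      rw [W, C_mul]; simp; ring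
    have e4 : W (m+1) p (m+1) = X * W (m+1) p m + C (p 0) := by rw [W]; simp
    rw [e1, e2, e3, e4, hS, C_add, C_add, map_sum, C_mul]
    ring

lemma dvd_of_dvd_X_mul (P c : Polynomial ℤ) (h0 : P.coeff 0 ≠ 0) (h : P ∣ X * c) : P ∣ c := by
  obtain ⟨s, hs⟩ := h
  have : s.coeff 0 = 0 := by
    have := congrArg (fun q => q.coeff 0) hs
    simp [mul_coeff_zero] at this
    tauto
  obtain ⟨s', rfl⟩ := X_dvd_iff.2 this
  refine ⟨s', mul_left_cancel₀ X_ne_zero (hs.trans (by ring))⟩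

lemma W_top_coeff (m : ℕ) (p : ℕ → ℤ) : (W (m+1) p (m+1)).coeff 0 = p 0 := by
  rw [W]; simp

lemma fwd (m : ℕ) (ε : ℝ) (p : ℕ → ℤ) (hp : 2 ≤ |p 0|) (s : ℤ)
    (hs : s = 1 ∧ 0 < p 0 ∨ s = -1 ∧ p 0 < 0) (l : ℕ) :
    ∀ (z : Fin (m + 1) → ℤ) (dig : ℕ → ℤ), (∀ j < l, IsDig ε (p 0) (dig j)) →
      W (m+1) p (m+1) ∣ C s * Phi (m+1) p z - ∑ j ∈ Finset.range l, C (dig j) * X ^ j →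
      (tauEps (m+1) (rv (m+1) p) ε)^[l] z = 0 := by
  have hss : (C s * C s : Polynomial ℤ) = 1 := by
    rw [← C_mul]; rcases hs with ⟨rfl, _⟩ | ⟨rfl, _⟩ <;> simp
  induction l with
  | zero =>
    intro z dig _ h
    refine Phi_zero_of_dvd _ p _ ?_
    have := h.mul_left (C s)
    rwa [Finset.sum_range_zero, sub_zero, ← mul_assoc, hss, one_mul] at this
  | succ l ih =>
    intro z dig hd h
    obtain ⟨δ, hδ, hdv⟩ := step m ε p hp s hs z
    set z' := tauEps (m+1) (rv (m+1) p) ε z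
    set P := W (m+1) p (m+1)
    rw [Finset.sum_range_succ'] at h
    have e : ∑ j ∈ Finset.range l, C (dig (j+1)) * X ^ (j+1)
        = X * ∑ j ∈ Finset.range l, C (dig (j+1)) * (X : Polynomial ℤ) ^ j := by
      rw [Finset.mul_sum]; exact Finset.sum_congr rfl fun j _ => by ring
    rw [e] at h
    have h2 : P ∣ C (s * δ - dig 0) + X * (C s * Phi (m+1) p z' -
        ∑ j ∈ Finset.range l, C (dig (j+1)) * X ^ j) := by
      have := h.sub (hdv.mul_left (C s))
      convert this using 1
      rw [C_sub, C_mul]; ring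
    have h3 : p 0 ∣ s * δ - dig 0 := by
      obtain ⟨q, hq⟩ := h2
      refine ⟨q.coeff 0, ?_⟩
      have := congrArg (fun q => q.coeff 0) hq
      simpa [mul_coeff_zero, P, W_top_coeff] using this
    have h4 := dig_unique hδ (hd 0 (by omega)) h3
    rw [h4, sub_self, C_0, zero_add] at h2
    rw [Function.iterate_succ_apply]
    refine ih z' (fun j => dig (j+1)) (fun j hj => hd _ (by omega)) ?_
    refine dvd_of_dvd_X_mul P _ ?_ h2
    rw [W_top_coeff]; intro h; simp [h] at hp

lemma bwd (m : ℕ) (ε : ℝ) (p : ℕ → ℤ) (hp : 2 ≤ |p 0|) (s : ℤ)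
    (hs : s = 1 ∧ 0 < p 0 ∨ s = -1 ∧ p 0 < 0) (l : ℕ) :
    ∀ (z : Fin (m + 1) → ℤ), (tauEps (m+1) (rv (m+1) p) ε)^[l] z = 0 →
      ∃ dig : ℕ → ℤ, (∀ j < l, IsDig ε (p 0) (dig j)) ∧
      W (m+1) p (m+1) ∣ C s * Phi (m+1) p z - ∑ j ∈ Finset.range l, C (dig j) * X ^ j := by
  induction l with
  | zero =>
    intro z h
    have : z = 0 := h
    exact ⟨0, by simp, by simp [this, Phi]⟩
  | succ l ih =>
    intro z h
    rw [Function.iterate_succ_apply] at h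
    obtain ⟨dig, hd, hdv⟩ := ih _ h
    obtain ⟨δ, hδ, hdv'⟩ := step m ε p hp s hs z
    refine ⟨fun j => Nat.casesOn j (s * δ) dig, ?_, ?_⟩
    · rintro (_ | j) hj
      · exact hδ
      · exact hd j (by omega)
    · rw [Finset.sum_range_succ']
      have e : ∑ j ∈ Finset.range l, C (dig j) * X ^ (j+1)
          = X * ∑ j ∈ Finset.range l, C (dig j) * (X : Polynomial ℤ) ^ j := by
        rw [Finset.mul_sum]; exact Finset.sum_congr rfl fun j _ => by ring
      have := (hdv'.mul_left (C s)).add (hdv.mul_left X)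
      convert this using 1
      simp only [e]
      change _ - (_ + C (s * δ) * X ^ 0) = _
      rw [C_mul]; ring

end EpsCNS

open EpsCNS in
theorem stmt_0 (d : ℕ) (hd : 1 ≤ d) (ε : ℝ) (hε0 : 0 ≤ ε) (hε1 : ε < 1)
    (p : ℕ → ℤ) (hp : 2 ≤ |p 0|) :
    IsEpsCNS ε (X ^ d + ∑ i ∈ Finset.range d, C (p i) * X ^ i) ↔
      (fun i : Fin d =>
          if (i : ℕ) = 0 then 1 / (p 0 : ℝ)
          else (p (d - (i : ℕ)) : ℝ) / (p 0 : ℝ)) ∈ SRSset d ε := by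
  obtain ⟨m, rfl⟩ : ∃ m, d = m + 1 := ⟨d - 1, by omega⟩
  have hP := W_eq (m+1) p (m+1) le_rfl
  simp only [Nat.sub_self, zero_add] at hP
  rw [← hP]
  change _ ↔ rv (m+1) p ∈ SRSset (m+1) ε
  obtain ⟨s, hs⟩ : ∃ s : ℤ, s = 1 ∧ 0 < p 0 ∨ s = -1 ∧ p 0 < 0 := by
    rcases lt_trichotomy (p 0) 0 with h | h | h
    · exact ⟨-1, Or.inr ⟨rfl, h⟩⟩
    · simp [h] at hp
    · exact ⟨1, Or.inl ⟨rfl, h⟩⟩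
  have hss : (C s * C s : Polynomial ℤ) = 1 := by
    rw [← C_mul]; rcases hs with ⟨rfl, _⟩ | ⟨rfl, _⟩ <;> simp
  constructor
  · intro h z
    obtain ⟨l, _, dig, hdig, hdv⟩ := h (C s * Phi (m+1) p z)
    rw [W_top_coeff] at hdig
    exact ⟨l, fwd m ε p hp s hs l z dig hdig hdv⟩
  · intro h a
    obtain ⟨z, hz⟩ := Phi_surj (m+1) p (C s * a)
    obtain ⟨k, hk⟩ := h z
    have hk' : (tauEps (m+1) (rv (m+1) p) ε)^[k+1] z = 0 := by
      rw [Function.iterate_succ_apply', hk]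
      funext i
      have : ⌊ε⌋ = 0 := Int.floor_eq_zero_iff.2 ⟨hε0, hε1⟩
      simp [tauEps, this]
    obtain ⟨dig, hdig, hdv⟩ := bwd m ε p hp s hs (k+1) z hk'
    refine ⟨k+1, by omega, dig, ?_, ?_⟩
    · rw [W_top_coeff]; exact hdig
    · have := (hz.mul_left (C s)).add hdv
      convert this using 1
      linear_combination -a * hss
end

section
/- Let P(x) = x² + p_1 x + p_0 ∈ ℤ[x]. Then P is a 0-CNS polynomial if and only if -1 ≤ p_1 ≤ p_0 and p_0 ≥ 2. -/
open Polynomial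

/-- State `(s,t)` stands for `(s + p1 t) + t x`. -/
inductive CRep (m p0 p1 : ℤ) : ℤ → ℤ → Prop
  | zero : CRep m p0 p1 0 0
  | step (s t t' : ℤ) (h0 : 0 ≤ s + p1 * t + p0 * t') (h1 : s + p1 * t + p0 * t' < m)
      (h : CRep m p0 p1 t t') : CRep m p0 p1 s t

theorem CRep.not_inv {m p0 p1 : ℤ} (I : ℤ → ℤ → Prop) (hz : ¬ I 0 0)
    (hI : ∀ s t t', I s t → 0 ≤ s + p1 * t + p0 * t' → s + p1 * t + p0 * t' < m → I t t')
    {s t : ℤ} (h : CRep m p0 p1 s t) : ¬ I s t := by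
  induction h with
  | zero => exact hz
  | step s t t' h0 h1 _ ih => exact fun h => ih (hI s t t' h h0 h1)

theorem CRep.add {m p0 p1 : ℤ} (E : ℤ → ℤ → Prop)
    (hR : ∀ s t, E s t → CRep m p0 p1 s t)
    (hE : ∀ s t d, E s t → 0 ≤ d → d < m → ∃ t', E t t' ∧
      0 ≤ d + s + p1 * t + p0 * t' ∧ d + s + p1 * t + p0 * t' < m)
    {s t : ℤ} (h : CRep m p0 p1 s t) : ∀ u v, E u v → CRep m p0 p1 (s + u) (t + v) := by
  induction h with
  | zero => intro u v h; simpa using hR u v h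
  | step s t t' h0 h1 _ ih =>
    intro u v h
    obtain ⟨w, hw, a, b⟩ := hE u v _ h h0 h1
    refine .step _ _ (t' + w) ?_ ?_ (ih _ _ hw)
    · linarith
    · linarith

theorem CRep.all {m p0 p1 : ℤ} (E : ℤ → ℤ → Prop)
    (hR : ∀ s t, E s t → CRep m p0 p1 s t)
    (hE : ∀ s t d, E s t → 0 ≤ d → d < m → ∃ t', E t t' ∧
      0 ≤ d + s + p1 * t + p0 * t' ∧ d + s + p1 * t + p0 * t' < m)
    (e1 : E 1 0) (e2 : E (-1) 0) (e3 : E 0 1) (e4 : E 0 (-1)) (s t : ℤ) :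
    CRep m p0 p1 s t := by
  have A : ∀ s, CRep m p0 p1 s 0 := by
    intro s
    induction s using Int.induction_on with
    | zero => exact .zero
    | succ i ih => simpa using CRep.add E hR hE ih _ _ e1
    | pred i ih => simpa [sub_eq_add_neg] using CRep.add E hR hE ih _ _ e2
  induction t using Int.induction_on with
  | zero => exact A s
  | succ i ih => simpa using CRep.add E hR hE ih _ _ e3
  | pred i ih => simpa [sub_eq_add_neg] using CRep.add E hR hE ih _ _ e4

theorem CRep.suff {p0 p1 : ℤ} (h1 : -1 ≤ p1) (h2 : p1 ≤ p0) (h3 : 2 ≤ p0) (s t : ℤ) :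
    CRep p0 p0 p1 s t := by
  have r10 : CRep p0 p0 p1 1 0 := .step _ _ 0 (by lia) (by lia) .zero
  rcases lt_trichotomy p1 0 with hp | hp | hp
  · obtain rfl : p1 = -1 := by lia
    have r11 : CRep p0 p0 (-1) 1 1 := .step _ _ 0 (by lia) (by lia) r10
    have r01 : CRep p0 p0 (-1) 0 1 := .step _ _ 1 (by lia) (by lia) r11
    have rm0 : CRep p0 p0 (-1) (-1) 0 := .step _ _ 1 (by lia) (by lia) r01
    have r0m : CRep p0 p0 (-1) 0 (-1) := .step _ _ 0 (by lia) (by lia) rm0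
    have rmm : CRep p0 p0 (-1) (-1) (-1) := .step _ _ 0 (by lia) (by lia) rm0
    refine CRep.all (fun s t => (s = 0 ∧ t = 0) ∨ (s = 1 ∧ t = 0) ∨ (s = 0 ∧ t = 1) ∨
      (s = 1 ∧ t = 1) ∨ (s = -1 ∧ t = 0) ∨ (s = 0 ∧ t = -1) ∨ (s = -1 ∧ t = -1)) ?_ ?_
      (by simp) (by simp) (by simp) (by simp) s t
    · rintro s t (⟨rfl, rfl⟩|⟨rfl, rfl⟩|⟨rfl, rfl⟩|⟨rfl, rfl⟩|⟨rfl, rfl⟩|⟨rfl, rfl⟩|⟨rfl, rfl⟩)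
      exacts [.zero, r10, r01, r11, rm0, r0m, rmm]
    · intro s t d h hd0 hd1
      by_cases c1 : d + s + -1 * t < 0
      · exact ⟨1, by lia, by lia, by lia⟩
      by_cases c2 : d + s + -1 * t < p0
      · exact ⟨0, by lia, by lia, by lia⟩
      · exact ⟨-1, by lia, by lia, by lia⟩
  · subst hp
    have r00 : CRep p0 p0 0 0 0 := .zero
    have r01 : CRep p0 p0 0 0 1 := .step _ _ 0 (by lia) (by lia) r10
    have r11 : CRep p0 p0 0 1 1 := .step _ _ 0 (by lia) (by lia) r10
    have rm0 : CRep p0 p0 0 (-1) 0 := .step _ _ 1 (by lia) (by lia) r01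
    have rm1 : CRep p0 p0 0 (-1) 1 := .step _ _ 1 (by lia) (by lia) r11
    have r0m : CRep p0 p0 0 0 (-1) := .step _ _ 0 (by lia) (by lia) rm0
    have r1m : CRep p0 p0 0 1 (-1) := .step _ _ 0 (by lia) (by lia) rm0
    have rmm : CRep p0 p0 0 (-1) (-1) := .step _ _ 1 (by lia) (by lia) rm1
    refine CRep.all (fun s t => (-1 ≤ s ∧ s ≤ 1) ∧ (-1 ≤ t ∧ t ≤ 1)) ?_ ?_
      (by simp) (by simp) (by simp) (by simp) s t
    · rintro s t ⟨⟨a, b⟩, c, d⟩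
      interval_cases s <;> interval_cases t <;> assumption
    · intro s t d h hd0 hd1
      by_cases c1 : d + s < 0
      · exact ⟨1, by lia, by lia, by lia⟩
      by_cases c2 : d + s < p0
      · exact ⟨0, by lia, by lia, by lia⟩
      · exact ⟨-1, by lia, by lia, by lia⟩
  · have rm1 : CRep p0 p0 p1 (-1) 1 := .step _ _ 0 (by lia) (by lia) r10
    have r0m : CRep p0 p0 p1 0 (-1) := .step _ _ 1 (by lia) (by lia) rm1
    have key : CRep p0 p0 p1 0 1 ∧ CRep p0 p0 p1 1 (-1) := by
      by_cases c : p1 < p0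
      · have r01 : CRep p0 p0 p1 0 1 := .step _ _ 0 (by lia) (by lia) r10
        refine ⟨r01, ?_⟩
        by_cases c' : p1 = 1
        · have rm0 : CRep p0 p0 p1 (-1) 0 := .step _ _ 1 (by lia) (by lia) r01
          exact .step _ _ 0 (by lia) (by lia) rm0
        · exact .step _ _ 1 (by lia) (by lia) rm1
      · have r1m : CRep p0 p0 p1 1 (-1) := .step _ _ 1 (by lia) (by lia) rm1
        exact ⟨.step _ _ (-1) (by lia) (by lia) r1m, r1m⟩
    obtain ⟨r01, r1m⟩ := key
    have rm0 : CRep p0 p0 p1 (-1) 0 := .step _ _ 1 (by lia) (by lia) r01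
    refine CRep.all (fun s t => (s = 0 ∧ t = 0) ∨ (s = 1 ∧ t = 0) ∨ (s = 0 ∧ t = 1) ∨
      (s = -1 ∧ t = 1) ∨ (s = -1 ∧ t = 0) ∨ (s = 0 ∧ t = -1) ∨ (s = 1 ∧ t = -1)) ?_ ?_
      (by simp) (by simp) (by simp) (by simp) s t
    · rintro s t (⟨rfl, rfl⟩|⟨rfl, rfl⟩|⟨rfl, rfl⟩|⟨rfl, rfl⟩|⟨rfl, rfl⟩|⟨rfl, rfl⟩|⟨rfl, rfl⟩)
      exacts [.zero, r10, r01, rm1, rm0, r0m, r1m]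
    · intro s t d h hd0 hd1
      by_cases c1 : d + s + p1 * t < 0
      · refine ⟨1, ?_⟩
        rcases h with (⟨rfl, rfl⟩|⟨rfl, rfl⟩|⟨rfl, rfl⟩|⟨rfl, rfl⟩|⟨rfl, rfl⟩|⟨rfl, rfl⟩|⟨rfl, rfl⟩) <;> lia
      by_cases c2 : d + s + p1 * t < p0
      · refine ⟨0, ?_⟩
        rcases h with (⟨rfl, rfl⟩|⟨rfl, rfl⟩|⟨rfl, rfl⟩|⟨rfl, rfl⟩|⟨rfl, rfl⟩|⟨rfl, rfl⟩|⟨rfl, rfl⟩) <;> lia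
      · refine ⟨-1, ?_⟩
        rcases h with (⟨rfl, rfl⟩|⟨rfl, rfl⟩|⟨rfl, rfl⟩|⟨rfl, rfl⟩|⟨rfl, rfl⟩|⟨rfl, rfl⟩|⟨rfl, rfl⟩) <;> lia

theorem CRep.nec {p0 p1 : ℤ} (hne : p0 ≠ 0) (H : ∀ s t, CRep |p0| p0 p1 s t) :
    -1 ≤ p1 ∧ p1 ≤ p0 ∧ 2 ≤ p0 := by
  rcases lt_or_gt_of_ne hne with hp | hp
  · exfalso
    rw [abs_of_neg hp] at H
    rcases le_or_gt 0 p1 with h1 | h1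
    · refine CRep.not_inv (fun s t => s < 0 ∧ t < 0) (by simp) ?_ (H (-1) (-1)) (by simp)
      rintro s t t' ⟨a, b⟩ c d
      refine ⟨b, ?_⟩
      by_contra hc
      nlinarith
    · rcases lt_or_ge (-p1) (-p0) with h2 | h2
      · refine CRep.not_inv (fun s t => (s = -1 ∧ t = 0) ∨ (s = 0 ∧ t = -1)) (by simp) ?_
          (H (-1) 0) (by simp)
        rintro s t t' (⟨rfl, rfl⟩ | ⟨rfl, rfl⟩) c d
        · right
          refine ⟨rfl, le_antisymm ?_ ?_⟩
          · by_contra hc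
            nlinarith
          · by_contra hc
            nlinarith
        · left
          refine ⟨rfl, le_antisymm ?_ ?_⟩
          · by_contra hc
            nlinarith
          · by_contra hc
            nlinarith
      · refine CRep.not_inv (fun s t => (s < 0 ∧ 0 < t) ∨ (0 < s ∧ t < 0)) (by simp) ?_
          (H (-1) 1) (by simp)
        rintro s t t' (⟨a, b⟩ | ⟨a, b⟩) c d
        · right
          refine ⟨b, ?_⟩
          by_contra hc
          nlinarith
        · left
          refine ⟨b, ?_⟩
          by_contra hc
          nlinarith
  · rw [abs_of_pos hp] at H
    have A : -1 ≤ p1 := by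
      by_contra hk
      rcases lt_or_ge p0 (-p1) with h2 | h2
      · refine CRep.not_inv (fun s t => 0 < t ∧ s ≤ t) (by simp) ?_ (H 0 1) (by simp)
        rintro s t t' ⟨a, b⟩ c d
        have : t ≤ t' := by
          by_contra hc
          nlinarith
        exact ⟨by lia, this⟩
      · refine CRep.not_inv (fun s t => s = 1 ∧ t = 1) (by simp) ?_ (H 1 1) (by simp)
        rintro s t t' ⟨rfl, rfl⟩ c d
        refine ⟨rfl, le_antisymm ?_ ?_⟩
        · by_contra hc
          nlinarith
        · by_contra hc
          nlinarith
    have B : p1 ≤ p0 := by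
      by_contra hk
      refine CRep.not_inv (fun s t => (0 < t ∧ -t ≤ s) ∨ (t < 0 ∧ s ≤ -t)) (by simp) ?_
        (H 0 1) (by simp)
      rintro s t t' (⟨a, b⟩ | ⟨a, b⟩) c d
      · right
        have : t' ≤ -t := by
          by_contra hc
          nlinarith
        exact ⟨by lia, by lia⟩
      · left
        have : -t ≤ t' := by
          by_contra hc
          nlinarith
        exact ⟨by lia, by lia⟩
    refine ⟨A, B, ?_⟩
    by_contra hk
    obtain rfl : p0 = 1 := by lia
    refine CRep.not_inv (fun s t => ¬ (s = 0 ∧ t = 0)) (by simp) ?_ (H 0 1) (by simp)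
    rintro s t t' h c d ⟨rfl, rfl⟩
    exact h ⟨by lia, rfl⟩

theorem CRep.toPoly {m p0 p1 : ℤ} (hm : 0 < m) {s t : ℤ} (h : CRep m p0 p1 s t) :
    ∃ l : ℕ, 0 < l ∧ ∃ dig : ℕ → ℤ, (∀ j < l, 0 ≤ dig j ∧ dig j < m) ∧
      (X ^ 2 + C p1 * X + C p0 : ℤ[X]) ∣
        (C (s + p1 * t) + C t * X) - ∑ j ∈ Finset.range l, C (dig j) * X ^ j := by
  induction h with
  | zero => exact ⟨1, one_pos, fun _ => 0, by simp [hm], by simp⟩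
  | step s t t' h0 h1 _ ih =>
    obtain ⟨l, hl, dig, hd, Q, hQ⟩ := ih
    refine ⟨l + 1, by lia, fun j => Nat.casesOn j (s + p1 * t + p0 * t') dig, ?_, X * Q - C t', ?_⟩
    · rintro (_ | j) hj
      · exact ⟨h0, h1⟩
      · exact hd j (by lia)
    · rw [Finset.sum_range_succ']
      have : ∑ k ∈ Finset.range l, C (dig k) * X ^ (k + 1)
          = X * ∑ k ∈ Finset.range l, C (dig k) * X ^ k := by
        rw [Finset.mul_sum]
        exact Finset.sum_congr rfl fun _ _ => by ring
      simp only [this]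
      change _ - (_ + C (s + p1 * t + p0 * t') * X ^ 0) = _
      simp only [map_add, map_mul] at hQ ⊢
      linear_combination X * hQ

theorem CRep.ofPoly {m p0 p1 : ℤ} (l : ℕ) : ∀ (s t : ℤ) (dig : ℕ → ℤ),
    (∀ j < l, 0 ≤ dig j ∧ dig j < m) →
      (X ^ 2 + C p1 * X + C p0 : ℤ[X]) ∣
        (C (s + p1 * t) + C t * X) - ∑ j ∈ Finset.range l, C (dig j) * X ^ j →
      CRep m p0 p1 s t := by
  induction l with
  | zero =>
    intro s t dig _ h
    have hdeg : (X ^ 2 + C p1 * X + C p0 : ℤ[X]).degree = 2 := by compute_degree!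
    have h0 : (C (s + p1 * t) + C t * X : ℤ[X]) = 0 := by
      refine Polynomial.eq_zero_of_dvd_of_degree_lt (p := X ^ 2 + C p1 * X + C p0)
        (by rwa [Finset.sum_range_zero, sub_zero] at h) ?_
      rw [hdeg]
      have : (C (s + p1 * t) + C t * X : ℤ[X]).degree ≤ 1 := by compute_degree
      exact lt_of_le_of_lt this (by norm_num)
    have a := congrArg (fun p => coeff p 1) h0
    have b := congrArg (fun p => coeff p 0) h0
    simp only [coeff_add, coeff_C_mul, coeff_X_one, coeff_X_zero, coeff_C_zero, coeff_C_succ,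
      coeff_zero, mul_one, mul_zero, zero_add, add_zero] at a b
    subst a
    obtain rfl : s = 0 := by simpa using b
    exact .zero
  | succ l ih =>
    rintro s t dig hd ⟨Q, hQ⟩
    rw [Finset.sum_range_succ'] at hQ
    have e : ∑ k ∈ Finset.range l, C (dig (k + 1)) * X ^ (k + 1)
          = X * ∑ k ∈ Finset.range l, C (dig (k + 1)) * X ^ k := by
        rw [Finset.mul_sum]
        exact Finset.sum_congr rfl fun _ _ => by ring
    rw [e] at hQ
    have h0 : s + p1 * t - dig 0 = p0 * Q.coeff 0 := by
      have := congrArg (eval 0) hQ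
      simpa [coeff_zero_eq_eval_zero] using this
    have e0 : s + p1 * t + p0 * (-Q.coeff 0) = dig 0 := by linarith
    have := hd 0 (by lia)
    refine .step _ _ (-Q.coeff 0) (by lia) (by lia) (ih _ _ (fun j => dig (j + 1))
      (fun j hj => hd _ (by lia)) ⟨Q.divX, ?_⟩)
    have hX := Polynomial.X_mul_divX_add Q
    have h0' := congrArg (C : ℤ → ℤ[X]) h0
    apply mul_left_cancel₀ (X_ne_zero : (X : ℤ[X]) ≠ 0)
    simp only [map_add, map_sub, map_mul, map_neg, pow_zero, mul_one] at hQ h0' ⊢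
    linear_combination hQ - h0' - (X ^ 2 + C p1 * X + C p0 : ℤ[X]) * hX

theorem stmt_1 (p0 p1 : ℤ) :
    IsEpsCNS 0 (X ^ 2 + C p1 * X + C p0) ↔ -1 ≤ p1 ∧ p1 ≤ p0 ∧ 2 ≤ p0 := by
  have hc : (X ^ 2 + C p1 * X + C p0 : ℤ[X]).coeff 0 = p0 := by simp
  have hdig : ∀ d : ℤ, (-((0:ℝ) * |(p0 : ℝ)|) ≤ (d : ℝ) ∧ (d : ℝ) < (1 - 0) * |(p0 : ℝ)|) ↔
      (0 ≤ d ∧ d < |p0|) := by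
    intro d
    simp only [zero_mul, neg_zero, sub_zero, one_mul]
    norm_cast
  unfold IsEpsCNS
  simp only [hc, hdig]
  constructor
  · intro H
    have hne : p0 ≠ 0 := by
      rintro rfl
      obtain ⟨l, hl, dig, hd, _⟩ := H 0
      have := hd 0 hl
      simp at this
      lia
    refine CRep.nec hne fun s t => ?_
    obtain ⟨l, hl, dig, hd, h⟩ := H (C (s + p1 * t) + C t * X)
    exact CRep.ofPoly l s t dig hd h
  · rintro ⟨h1, h2, h3⟩ a
    rw [abs_of_pos (by lia)]
    have hm : (X ^ 2 + C p1 * X + C p0 : ℤ[X]).Monic := by monicity!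
    have hdeg : (X ^ 2 + C p1 * X + C p0 : ℤ[X]).natDegree = 2 := by compute_degree!
    have hlt := natDegree_modByMonic_lt a hm (by intro h; rw [h] at hdeg; simp at hdeg)
    obtain ⟨b, c, hbc⟩ := exists_eq_X_add_C_of_natDegree_le_one
      (show (a %ₘ (X ^ 2 + C p1 * X + C p0)).natDegree ≤ 1 by lia)
    obtain ⟨l, hl, dig, hd, Q, hQ⟩ := CRep.toPoly (by lia) (CRep.suff h1 h2 h3 (c - p1 * b) b)
    refine ⟨l, hl, dig, hd, Q + a /ₘ (X ^ 2 + C p1 * X + C p0), ?_⟩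
    have hdiv := modByMonic_add_div a (X ^ 2 + C p1 * X + C p0 : ℤ[X])
    rw [hbc] at hdiv
    rw [sub_add_cancel] at hQ
    linear_combination hQ - hdiv
end

section
/- Let P(x) = x² + p_1 x + p_0 ∈ ℤ[x] with |p_0| ≥ 2. Then P is a (1/2)-CNS polynomial if and only if one of the following holds: (i) |p_0| is odd, |p_0| ≥ 3, and |p_1| ≤ sgn(p_0) + (|p_0|-1)/2; (ii) |p_0| is even, |p_0| ≥ 4, and either |p_1| ≤ sgn(p_0) - 1 + |p_0|/2 or p_1 = 1 + p_0/2; (iii) p_0 = 2 and -1 ≤ p_1 ≤ 2. -/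
open Polynomial

/-- Orbit-termination predicate in the coordinates `-(u + p1 v) - v X`. -/
inductive Good (p0 p1 : ℤ) : ℤ → ℤ → Prop
  | zero : Good p0 p1 0 0
  | step (u v w d : ℤ) (h1 : -|p0| ≤ 2 * d) (h2 : 2 * d < |p0|)
      (h : -(u + p1 * v) = d + p0 * w) (hg : Good p0 p1 v w) : Good p0 p1 u v

lemma ex_step (p0 p1 : ℤ) (hp : 2 ≤ |p0|) (u v : ℤ) :
    ∃ w d : ℤ, -|p0| ≤ 2 * d ∧ 2 * d < |p0| ∧ -(u + p1 * v) = d + p0 * w := by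
  set B := -(u + p1 * v) with hB
  have h1 := Int.emod_add_mul_ediv B |p0|
  have h2 := Int.emod_nonneg B (b := |p0|) (by omega)
  have h3 := Int.emod_lt_of_pos B (b := |p0|) (by omega)
  set r := B % |p0|
  set q := B / |p0|
  clear_value r q B
  rcases abs_cases p0 with ⟨h, _⟩ | ⟨h, _⟩
  · rw [h] at h1 h3 hp ⊢
    by_cases hr : 2 * r < p0
    · exact ⟨q, r, by omega, by omega, by rw [← h1]⟩
    · exact ⟨q + 1, r - p0, by omega, by omega, by rw [← h1]; ring⟩
  · rw [h] at h1 h3 hp ⊢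
    by_cases hr : 2 * r < -p0
    · exact ⟨-q, r, by omega, by omega, by rw [← h1]; ring⟩
    · exact ⟨-(q + 1), r + p0, by omega, by omega, by rw [← h1]; ring⟩

lemma dig_uniq (p0 d w d' w' : ℤ) (h1 : -|p0| ≤ 2 * d) (h2 : 2 * d < |p0|)
    (h1' : -|p0| ≤ 2 * d') (h2' : 2 * d' < |p0|) (h : d + p0 * w = d' + p0 * w') :
    w = w' := by
  by_contra hne
  have : p0 * (w - w') = d' - d := by linarith
  have h3 : |p0| * |w - w'| = |d' - d| := by rw [← abs_mul, this]
  have h4 : 1 ≤ |w - w'| := Int.one_le_abs (sub_ne_zero.mpr hne)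
  have h5 : |d' - d| < |p0| := by rw [abs_lt]; constructor <;> omega
  nlinarith [abs_nonneg p0]

lemma not_good (p0 p1 : ℤ) (S : ℤ → ℤ → Prop) (h0 : ¬ S 0 0)
    (hS : ∀ u v w d : ℤ, -|p0| ≤ 2 * d → 2 * d < |p0| → -(u + p1 * v) = d + p0 * w →
      S u v → S v w) (u v : ℤ) (h : Good p0 p1 u v) : ¬ S u v := by
  induction h with
  | zero => exact h0
  | step u v w d h1 h2 h hg ih => exact fun hs => ih (hS u v w d h1 h2 h hs)

/-! polynomial side -/

lemma good_rep (p0 p1 : ℤ) (u v : ℤ) (h : Good p0 p1 u v) :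
    ∃ l : ℕ, ∃ dig : ℕ → ℤ, (∀ j < l, -|p0| ≤ 2 * dig j ∧ 2 * dig j < |p0|) ∧
      (X ^ 2 + C p1 * X + C p0 : ℤ[X]) ∣
        (-C (u + p1 * v) - C v * X) - ∑ j ∈ Finset.range l, C (dig j) * X ^ j := by
  induction h with
  | zero => exact ⟨0, fun _ => 0, by simp, by simp⟩
  | step u v w d h1 h2 h hg ih =>
    obtain ⟨l, dig, hd, Q, hQ⟩ := ih
    refine ⟨l + 1, fun j => if j = 0 then d else dig (j - 1), ?_, C w + X * Q, ?_⟩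
    · intro j hj
      by_cases hj0 : j = 0
      · simp [hj0, h1, h2]
      · simp only [hj0, if_false]
        exact hd (j - 1) (by omega)
    · rw [Finset.sum_range_succ']
      have e : ∑ k ∈ Finset.range l,
          C (if k + 1 = 0 then d else dig (k + 1 - 1)) * (X : ℤ[X]) ^ (k + 1)
          = X * ∑ j ∈ Finset.range l, C (dig j) * X ^ j := by
        rw [Finset.mul_sum]
        refine Finset.sum_congr rfl fun k _ => ?_
        simp [pow_succ]; ring
      rw [e]
      have hc : -C (u + p1 * v) = (C d + C p0 * C w : ℤ[X]) := by
        rw [← C_neg, h]; simp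
      simp only [if_true, pow_zero, mul_one]
      rw [hc]
      simp only [C_add, C_mul] at hQ
      linear_combination X * hQ

lemma rep_good (p0 p1 : ℤ) (hp : 2 ≤ |p0|) (l : ℕ) : ∀ (u v : ℤ) (dig : ℕ → ℤ),
    (∀ j < l, -|p0| ≤ 2 * dig j ∧ 2 * dig j < |p0|) →
      (X ^ 2 + C p1 * X + C p0 : ℤ[X]) ∣
        (-C (u + p1 * v) - C v * X) - ∑ j ∈ Finset.range l, C (dig j) * X ^ j →
      Good p0 p1 u v := by
  have hm : (X ^ 2 + C p1 * X + C p0 : ℤ[X]).Monic := by monicity!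
  have hdeg : (X ^ 2 + C p1 * X + C p0 : ℤ[X]).natDegree = 2 := by compute_degree!
  induction l with
  | zero =>
    intro u v dig _ h
    simp only [Finset.range_zero, Finset.sum_empty, sub_zero] at h
    have h0 : (-C (u + p1 * v) - C v * X : ℤ[X]) = 0 := by
      apply Polynomial.eq_zero_of_dvd_of_natDegree_lt h
      rw [hdeg]
      have : (-C (u + p1 * v) - C v * X : ℤ[X]).natDegree ≤ 1 := by compute_degree
      omega
    have c1 := congrArg (fun f => coeff f 1) h0
    have c0 := congrArg (fun f => coeff f 0) h0
    simp only [coeff_sub, coeff_neg, coeff_C_mul, coeff_X_one, coeff_C_succ, coeff_zero] at c1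
    simp at c0
    have c1 : v = 0 := by linarith
    subst c1
    have : u = 0 := by simpa using c0
    subst this
    exact Good.zero
  | succ l ih =>
    intro u v dig hd h
    obtain ⟨Q, hQ⟩ := h
    rw [Finset.sum_range_succ'] at hQ
    have e : ∑ k ∈ Finset.range l, C (dig (k + 1)) * (X : ℤ[X]) ^ (k + 1)
          = X * ∑ j ∈ Finset.range l, C (dig (j + 1)) * X ^ j := by
        rw [Finset.mul_sum]
        refine Finset.sum_congr rfl fun k _ => ?_
        simp [pow_succ]; ring
    rw [e] at hQ
    obtain ⟨Q', w, rfl⟩ : ∃ (Q' : ℤ[X]) (w : ℤ), Q = X * Q' + C w :=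
      ⟨Q.divX, Q.coeff 0, (X_mul_divX_add Q).symm⟩
    have c0 := congrArg (fun f => eval 0 f) hQ
    simp at c0
    have hh : -(u + p1 * v) = dig 0 + p0 * w := by linarith
    refine Good.step u v w (dig 0) (hd 0 (by omega)).1 (hd 0 (by omega)).2 hh ?_
    refine ih v w (fun j => dig (j + 1)) (fun j hj => hd (j + 1) (by omega)) ⟨Q', ?_⟩
    have hc : -C (u + p1 * v) = (C (dig 0) + C p0 * C w : ℤ[X]) := by
        rw [← C_neg, hh]; simp
    rw [hc] at hQ
    simp only [pow_zero, mul_one] at hQ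
    apply mul_left_cancel₀ (X_ne_zero : (X : ℤ[X]) ≠ 0)
    simp only [C_add, C_mul]
    linear_combination hQ

lemma cns_iff (p0 p1 : ℤ) (hp : 2 ≤ |p0|) :
    IsEpsCNS (1/2) (X ^ 2 + C p1 * X + C p0) ↔ ∀ u v, Good p0 p1 u v := by
  have hm : (X ^ 2 + C p1 * X + C p0 : ℤ[X]).Monic := by monicity!
  have hdeg : (X ^ 2 + C p1 * X + C p0 : ℤ[X]).natDegree = 2 := by compute_degree!
  have hc : (X ^ 2 + C p1 * X + C p0 : ℤ[X]).coeff 0 = p0 := by simp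
  have hdig : ∀ d : ℤ, (-((1/2 : ℝ) * |(p0 : ℝ)|) ≤ (d : ℝ) ∧
        (d : ℝ) < (1 - (1/2 : ℝ)) * |(p0 : ℝ)|) ↔ (-|p0| ≤ 2 * d ∧ 2 * d < |p0|) := by
    intro d
    have a1 : (-|p0| ≤ 2 * d) ↔ (-|(p0 : ℝ)| ≤ 2 * (d : ℝ)) := by
      exact_mod_cast Iff.rfl
    have a2 : (2 * d < |p0|) ↔ (2 * (d : ℝ) < |(p0 : ℝ)|) := by
      exact_mod_cast Iff.rfl
    rw [a1, a2]
    constructor <;> rintro ⟨h1, h2⟩ <;> constructor <;> linarith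
  unfold IsEpsCNS
  rw [hc]
  simp only [hdig]
  constructor
  · intro h u v
    obtain ⟨l, _, dig, h1, h2⟩ := h (-C (u + p1 * v) - C v * X)
    exact rep_good p0 p1 hp l u v dig h1 h2
  · intro h a
    set P := (X ^ 2 + C p1 * X + C p0 : ℤ[X])
    have hlt : (a %ₘ P).natDegree < 2 := by
      rw [← hdeg]
      refine natDegree_modByMonic_lt a hm ?_
      intro h1
      rw [h1] at hdeg; simp at hdeg
    obtain ⟨r1, r0, hr⟩ := exists_eq_X_add_C_of_natDegree_le_one (show (a %ₘ P).natDegree ≤ 1 by omega)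
    obtain ⟨l, dig, h1, h2⟩ := good_rep p0 p1 _ _ (h (p1 * r1 - r0) (-r1))
    have key : P ∣ a - ∑ j ∈ Finset.range l, C (dig j) * X ^ j := by
      have hdm := modByMonic_add_div a P
      have e : a - ∑ j ∈ Finset.range l, C (dig j) * X ^ j
        = P * (a /ₘ P) + ((-C ((p1 * r1 - r0) + p1 * (-r1)) - C (-r1) * X)
          - ∑ j ∈ Finset.range l, C (dig j) * X ^ j) := by
        rw [hr] at hdm
        simp only [C_add, C_mul, C_neg, C_sub]
        linear_combination -hdm
      rw [e]
      exact dvd_add (dvd_mul_right _ _) h2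
    refine ⟨l + 1, by omega, fun j => if j < l then dig j else 0, ?_, ?_⟩
    · intro j hj
      by_cases hjl : j < l
      · simpa [hjl] using h1 j hjl
      · simp only [hjl, if_false]; omega
    · rw [Finset.sum_range_succ]
      have : ∑ j ∈ Finset.range l, C (if j < l then dig j else 0) * (X : ℤ[X]) ^ j
         = ∑ j ∈ Finset.range l, C (dig j) * X ^ j :=
        Finset.sum_congr rfl fun j hj => by simp [Finset.mem_range.mp hj]
      rw [this]
      simpa using key

/-! necessity -/

lemma nec_pp (p0 p1 : ℤ) (hp : 2 ≤ p0) (h : p0 < 2 * (p1 - 1)) :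
    ∃ u v, ¬ Good p0 p1 u v := by
  have ha : |p0| = p0 := abs_of_pos (by omega)
  by_cases hg : 2 * (p1 - 1) < 3 * p0
  · refine ⟨1, -1, fun H => not_good p0 p1
      (fun u v => (u = 1 ∧ v = -1) ∨ (u = -1 ∧ v = 1)) (by simp) ?_ _ _ H (by simp)⟩
    rintro u v w d h1 h2 h3 (⟨rfl, rfl⟩ | ⟨rfl, rfl⟩)
    · right
      refine ⟨rfl, dig_uniq p0 d w (p1 - 1 - p0) 1 h1 h2 ?_ ?_ ?_⟩ <;> omega
    · left
      refine ⟨rfl, dig_uniq p0 d w (1 - p1 + p0) (-1) h1 h2 ?_ ?_ ?_⟩ <;> omega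
  · refine ⟨1, -1, fun H => not_good p0 p1
      (fun u v => (1 ≤ u ∧ u ≤ -v) ∨ (1 ≤ -u ∧ -u ≤ v)) (by simp) ?_ _ _ H (by simp)⟩
    rintro u v w d h1 h2 h3 (⟨a, b⟩ | ⟨a, b⟩)
    · right
      refine ⟨by omega, ?_⟩
      by_contra hc
      nlinarith [mul_nonneg (show 0 ≤ 2 * (p1 - 1) - 3 * p0 by omega) (show 0 ≤ -v by omega),
        mul_nonneg (show 0 ≤ p0 by omega) (show 0 ≤ -v - 1 - w by omega),
        mul_nonneg (show 0 ≤ p0 by omega) (show 0 ≤ -v by omega)]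
    · left
      refine ⟨by omega, ?_⟩
      by_contra hc
      nlinarith [mul_nonneg (show 0 ≤ 2 * (p1 - 1) - 3 * p0 by omega) (show 0 ≤ v by omega),
        mul_nonneg (show 0 ≤ p0 by omega) (show 0 ≤ v - 1 + w by omega),
        mul_nonneg (show 0 ≤ p0 by omega) (show 0 ≤ v by omega)]

lemma nec_pn (p0 p1 : ℤ) (hp : 2 ≤ p0) (h : p0 ≤ 2 * (-p1 - 1)) :
    ∃ u v, ¬ Good p0 p1 u v := by
  have ha : |p0| = p0 := abs_of_pos (by omega)
  by_cases hg : 2 * (-p1 - 1) < 3 * p0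
  · refine ⟨1, 1, fun H => not_good p0 p1
      (fun u v => (u = 1 ∧ v = 1)) (by simp) ?_ _ _ H (by simp)⟩
    rintro u v w d h1 h2 h3 ⟨rfl, rfl⟩
    refine ⟨rfl, dig_uniq p0 d w (-p1 - 1 - p0) 1 h1 h2 ?_ ?_ ?_⟩ <;> omega
  · refine ⟨1, 1, fun H => not_good p0 p1
      (fun u v => (1 ≤ u ∧ u ≤ v)) (by simp) ?_ _ _ H (by simp)⟩
    rintro u v w d h1 h2 h3 ⟨a, b⟩
    refine ⟨by omega, ?_⟩
    by_contra hc
    nlinarith [mul_nonneg (show 0 ≤ 2 * (-p1 - 1) - 3 * p0 by omega) (show 0 ≤ v by omega),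
        mul_nonneg (show 0 ≤ p0 by omega) (show 0 ≤ v - 1 - w by omega),
        mul_nonneg (show 0 ≤ p0 by omega) (show 0 ≤ v by omega)]

lemma nec_np (p0 p1 : ℤ) (hp : 2 ≤ -p0) (h : -p0 ≤ 2 * (p1 + 1)) :
    ∃ u v, ¬ Good p0 p1 u v := by
  have ha : |p0| = -p0 := abs_of_neg (by omega)
  by_cases hg : 2 * (p1 + 1) < 3 * (-p0)
  · refine ⟨-1, -1, fun H => not_good p0 p1
      (fun u v => (u = -1 ∧ v = -1)) (by simp) ?_ _ _ H (by simp)⟩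
    rintro u v w d h1 h2 h3 ⟨rfl, rfl⟩
    refine ⟨rfl, dig_uniq p0 d w (p1 + 1 + p0) (-1) h1 h2 ?_ ?_ ?_⟩ <;> omega
  · refine ⟨-1, -1, fun H => not_good p0 p1
      (fun u v => (1 ≤ -u ∧ v ≤ u)) (by simp) ?_ _ _ H (by simp)⟩
    rintro u v w d h1 h2 h3 ⟨a, b⟩
    refine ⟨by omega, ?_⟩
    by_contra hc
    nlinarith [mul_nonneg (show 0 ≤ 2 * (p1 + 1) - 3 * (-p0) by omega) (show 0 ≤ -v by omega),
        mul_nonneg (show 0 ≤ -p0 by omega) (show 0 ≤ w - v - 1 by omega),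
        mul_nonneg (show 0 ≤ -p0 - 2 by omega) (show 0 ≤ -v - 1 by omega)]

lemma nec_nn (p0 p1 : ℤ) (hp : 2 ≤ -p0) (h : -p0 < 2 * (-p1 + 1)) :
    ∃ u v, ¬ Good p0 p1 u v := by
  have ha : |p0| = -p0 := abs_of_neg (by omega)
  by_cases hg : 2 * (-p1 + 1) < 3 * (-p0)
  · refine ⟨1, -1, fun H => not_good p0 p1
      (fun u v => (u = 1 ∧ v = -1) ∨ (u = -1 ∧ v = 1)) (by simp) ?_ _ _ H (by simp)⟩
    rintro u v w d h1 h2 h3 (⟨rfl, rfl⟩ | ⟨rfl, rfl⟩)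
    · right
      refine ⟨rfl, dig_uniq p0 d w (p1 - 1 - p0) 1 h1 h2 ?_ ?_ ?_⟩ <;> omega
    · left
      refine ⟨rfl, dig_uniq p0 d w (1 - p1 + p0) (-1) h1 h2 ?_ ?_ ?_⟩ <;> omega
  · refine ⟨1, -1, fun H => not_good p0 p1
      (fun u v => (1 ≤ u ∧ u ≤ -v) ∨ (1 ≤ -u ∧ -u ≤ v)) (by simp) ?_ _ _ H (by simp)⟩
    rintro u v w d h1 h2 h3 (⟨a, b⟩ | ⟨a, b⟩)
    · right
      refine ⟨by omega, ?_⟩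
      by_contra hc
      nlinarith [mul_nonneg (show 0 ≤ 2 * (-p1 + 1) - 3 * (-p0) by omega) (show 0 ≤ -v by omega),
        mul_nonneg (show 0 ≤ -p0 by omega) (show 0 ≤ -v - 1 - w by omega),
        mul_nonneg (show 0 ≤ -p0 - 2 by omega) (show 0 ≤ -v - 1 by omega)]
    · left
      refine ⟨by omega, ?_⟩
      by_contra hc
      nlinarith [mul_nonneg (show 0 ≤ 2 * (-p1 + 1) - 3 * (-p0) by omega) (show 0 ≤ v by omega),
        mul_nonneg (show 0 ≤ -p0 by omega) (show 0 ≤ v - 1 + w by omega),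
        mul_nonneg (show 0 ≤ -p0 - 2 by omega) (show 0 ≤ v - 1 by omega)]

/-! sufficiency -/

lemma wbound (p0 B w d n : ℤ) (hn : 1 ≤ n) (h1 : -|p0| ≤ 2 * d) (h2 : 2 * d < |p0|)
    (h : B = d + p0 * w) (hp : 5 ≤ |p0|) (hB : 2 * |B| ≤ (n + 1) * (|p0| + 2)) : |w| ≤ n := by
  by_contra hc
  have e : |p0| * |w| = |B - d| := by rw [← abs_mul, h]; ring_nf
  have e2 : |B - d| ≤ |B| + |d| := abs_sub _ _
  have e3 : 2 * |d| ≤ |p0| := by rcases abs_cases d with ⟨h, _⟩ | ⟨h, _⟩ <;> omega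
  nlinarith [mul_nonneg (show 0 ≤ |p0| by omega) (show 0 ≤ |w| - n - 1 by omega),
    mul_nonneg (show 0 ≤ |p0| - 5 by omega) (show 0 ≤ n by omega)]

lemma wbound' (p0 B w d n : ℤ) (hn : 1 ≤ n) (h1 : -|p0| ≤ 2 * d) (h2 : 2 * d < |p0|)
    (h : B = d + p0 * w) (hp : 3 ≤ |p0|) (hB : 2 * |B| ≤ (n + 1) * |p0|) : |w| ≤ n := by
  by_contra hc
  have e : |p0| * |w| = |B - d| := by rw [← abs_mul, h]; ring_nf
  have e2 : |B - d| ≤ |B| + |d| := abs_sub _ _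
  have e3 : 2 * |d| ≤ |p0| := by rcases abs_cases d with ⟨h, _⟩ | ⟨h, _⟩ <;> omega
  nlinarith [mul_nonneg (show 0 ≤ |p0| by omega) (show 0 ≤ |w| - n - 1 by omega),
    mul_nonneg (show 0 ≤ |p0| - 3 by omega) (show 0 ≤ n by omega)]

lemma lin_abs (a b u v M : ℤ) (hu : |u| ≤ M) (hv : |v| ≤ M) :
    |a * u + b * v| ≤ (|a| + |b|) * M := by
  calc |a * u + b * v| ≤ |a * u| + |b * v| := abs_add_le _ _
    _ = |a| * |u| + |b| * |v| := by rw [abs_mul, abs_mul]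
    _ ≤ |a| * M + |b| * M := by gcongr
    _ = _ := by ring

/-- The base box. -/
lemma box (p0 p1 : ℤ) (hp : 3 ≤ |p0|)
    (h : (0 < p0 ∧ 2 * |p1| ≤ p0 + 1) ∨ (0 < p0 ∧ 2 * p1 = p0 + 2) ∨
      (p0 < 0 ∧ 2 * (|p1| + 1) ≤ -p0 ∧ 2 * (p1 + 1) < -p0)) (hp' : 5 ≤ |p0| ∨ p0 < 0)
    (u v : ℤ) (hu : |u| ≤ 1) (hv : |v| ≤ 1) : Good p0 p1 u v := by
  have st : ∀ u v w : ℤ, Good p0 p1 v w → -|p0| ≤ 2 * (-(u + p1 * v) - p0 * w) →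
      2 * (-(u + p1 * v) - p0 * w) < |p0| → Good p0 p1 u v := fun u v w hg h1 h2 =>
    Good.step u v w _ h1 h2 (by ring) hg
  have g0 : Good p0 p1 0 0 := Good.zero
  have g1 : Good p0 p1 1 0 := st _ _ 0 g0 (by omega) (by omega)
  have g2 : Good p0 p1 (-1) 0 := st _ _ 0 g0 (by omega) (by omega)
  have g : ∀ v : ℤ, |v| ≤ 1 → Good p0 p1 v 0 := by
    intro v hv
    rw [abs_le] at hv
    obtain rfl | rfl | rfl : v = -1 ∨ v = 0 ∨ v = 1 := by omega
    all_goals assumption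
  have stA : ∀ u v w : ℤ, |v| ≤ 1 → Good p0 p1 v w →
      (-|p0| ≤ 2 * (-(u + p1 * v)) ∧ 2 * (-(u + p1 * v)) < |p0|) ∨
      (-|p0| ≤ 2 * (-(u + p1 * v) - p0 * w) ∧
      2 * (-(u + p1 * v) - p0 * w) < |p0|) → Good p0 p1 u v := by
    rintro u v w hv hg (⟨h1, h2⟩ | ⟨h1, h2⟩)
    · exact st u v 0 (g v hv) (by linarith) (by linarith)
    · exact st u v w hg h1 h2
  by_cases hv0 : v = 0
  · rw [hv0]; exact g u hu
  rw [abs_le] at hu hv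
  clear g st
  have hv1 : v = 1 ∨ v = -1 := by omega
  clear hv hv0
  rcases le_or_gt 0 p0 with hs | hs
  · rw [abs_of_nonneg hs] at hp hp' stA
    rcases le_or_gt 0 p1 with hq | hq
    · rw [abs_of_nonneg hq] at h
      have a : Good p0 p1 (-1) 1 := stA _ _ 0 (by simp) g1 (by omega)
      have b : Good p0 p1 1 (-1) := stA _ _ 1 (by simp) a (by omega)
      rcases hv1 with rfl | rfl
      · exact stA _ _ (-1) (by simp) b (by omega)
      · exact stA _ _ 1 (by simp) a (by omega)
    · rw [abs_of_neg hq] at h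
      have a : Good p0 p1 1 1 := stA _ _ 0 (by simp) g1 (by omega)
      have b : Good p0 p1 (-1) (-1) := stA _ _ 0 (by simp) g2 (by omega)
      rcases hv1 with rfl | rfl
      · exact stA _ _ 1 (by simp) a (by omega)
      · exact stA _ _ (-1) (by simp) b (by omega)
  · rw [abs_of_neg hs] at hp hp' stA
    rcases le_or_gt 0 p1 with hq | hq
    · rw [abs_of_nonneg hq] at h
      have a : Good p0 p1 1 1 := stA _ _ 0 (by simp) g1 (by omega)
      have b : Good p0 p1 (-1) (-1) := stA _ _ (-1) (by simp)
        (stA _ _ 0 (by simp) g2 (by omega)) (by omega)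
      rcases hv1 with rfl | rfl
      · exact stA _ _ 1 (by simp) a (by omega)
      · exact stA _ _ (-1) (by simp) b (by omega)
    · rw [abs_of_neg hq] at h
      have b : Good p0 p1 1 (-1) := stA _ _ 0 (by simp) g2 (by omega)
      have a : Good p0 p1 (-1) 1 := stA _ _ (-1) (by simp) b (by omega)
      rcases hv1 with rfl | rfl
      · exact stA _ _ (-1) (by simp) b (by omega)
      · exact stA _ _ 1 (by simp) a (by omega)

lemma descent (p0 p1 : ℤ) (hp : 2 ≤ |p0|) (A A' : ℤ → ℤ → ℤ → Prop)
    (hb : ∀ u v, A 1 u v → Good p0 p1 u v)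
    (h1 : ∀ n u v w d, 1 ≤ n → -|p0| ≤ 2 * d → 2 * d < |p0| → -(u + p1 * v) = d + p0 * w →
      A (n + 1) u v → A' n v w)
    (h2 : ∀ n u v w d, 1 ≤ n → -|p0| ≤ 2 * d → 2 * d < |p0| → -(u + p1 * v) = d + p0 * w →
      A' n u v → A n v w) (n : ℕ) : ∀ u v, A (n + 1) u v → Good p0 p1 u v := by
  induction n with
  | zero => intro u v h; exact hb u v (by simpa using h)
  | succ n ih =>
    intro u v h
    obtain ⟨w, d, a1, a2, a3⟩ := ex_step p0 p1 hp u v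
    obtain ⟨x, d', b1, b2, b3⟩ := ex_step p0 p1 hp v w
    refine Good.step u v w d a1 a2 a3 (Good.step v w x d' b1 b2 b3 (ih w x ?_))
    refine h2 _ v w x d' (by omega) b1 b2 b3 (h1 _ u v w d (by omega) a1 a2 a3 ?_)
    push_cast at h
    exact h

lemma suff_sup (p0 p1 : ℤ) (h : (5 ≤ p0 ∧ 2 * |p1| ≤ p0) ∨
      (p0 ≤ -3 ∧ 2 * (|p1| + 1) ≤ -p0 ∧ 2 * (p1 + 1) < -p0)) (u v : ℤ) : Good p0 p1 u v := by
  have hp : 3 ≤ |p0| := by rcases abs_cases p0 with ⟨h, _⟩ | ⟨h, _⟩ <;> omega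
  have key : ∀ n u v w d, 1 ≤ n → -|p0| ≤ 2 * d → 2 * d < |p0| → -(u + p1 * v) = d + p0 * w →
      |u| ≤ n + 1 → |v| ≤ n + 1 → |w| ≤ n := by
    intro n u v w d hn h1 h2 h3 hu hv
    have hl := lin_abs 1 p1 u v _ hu hv
    have e : |(-(u + p1 * v))| = |1 * u + p1 * v| := by rw [abs_neg, one_mul]
    rw [← e, abs_one] at hl
    rcases h with ⟨a, b⟩ | ⟨a, b, _⟩
    · refine wbound p0 _ w d n hn h1 h2 h3 ?_ ?_
      · rw [abs_of_nonneg (by omega)]; exact a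
      · rw [abs_of_nonneg (show 0 ≤ p0 by omega)]
        nlinarith
    · refine wbound' p0 _ w d n hn h1 h2 h3 hp ?_
      rw [abs_of_neg (show p0 < 0 by omega)]
      nlinarith
  refine descent p0 p1 (by omega) (fun n u v => |u| ≤ n ∧ |v| ≤ n)
    (fun n u v => |u| ≤ n + 1 ∧ |v| ≤ n) ?_ ?_ ?_ (max |u| |v|).toNat u v ?_
  · rintro u v ⟨a, b⟩
    refine box p0 p1 hp ?_ ?_ u v a b
    · omega
    · rcases abs_cases p0 with ⟨h, _⟩ | ⟨h, _⟩ <;> omega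
  · rintro n u v w d hn a1 a2 a3 ⟨b1, b2⟩
    exact ⟨b2, key n u v w d hn a1 a2 a3 b1 b2⟩
  · rintro n u v w d hn a1 a2 a3 ⟨b1, b2⟩
    exact ⟨b2, key n u v w d hn a1 a2 a3 b1 (by omega)⟩
  · have := le_max_left |u| |v|
    have := le_max_right |u| |v|
    constructor <;> omega

lemma suff_hex (p0 p1 e q : ℤ) (he : e = 1 ∨ e = -1) (hp5 : 5 ≤ p0) (hq : p1 = e * q)
    (hq1 : p0 ≤ 2 * q) (hq2 : 2 * q ≤ p0 + 2) (h : 2 * q ≤ p0 + 1 ∨ (e = 1 ∧ 2 * q = p0 + 2))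
    (u v : ℤ) : Good p0 p1 u v := by
  have ha : |p0| = p0 := abs_of_pos (by omega)
  have hee : e * e = 1 := by rcases he with rfl | rfl <;> rfl
  have hea : |e| = 1 := by rcases he with rfl | rfl <;> rfl
  have key : ∀ n u v w d, 1 ≤ n → -|p0| ≤ 2 * d → 2 * d < |p0| → -(u + p1 * v) = d + p0 * w →
      |u| ≤ n + 1 → |v| ≤ n + 1 → |u + e * v| ≤ n + 1 → |w| ≤ n ∧ |v + e * w| ≤ n := by
    intro n u v w d hn h1 h2 h3 hu hv huv
    constructor
    · have hl := lin_abs 1 (e * (q - 1)) (u + e * v) v _ huv hv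
      have e1 : |(-(u + p1 * v))| = |1 * (u + e * v) + (e * (q - 1)) * v| := by
        rw [abs_neg, hq]; ring_nf
      rw [← e1, abs_one, abs_mul, hea, abs_of_nonneg (show 0 ≤ q - 1 by omega)] at hl
      refine wbound p0 _ w d n hn h1 h2 h3 (by omega) ?_
      rw [ha]; nlinarith
    · have hl := lin_abs (-1) (e * (p0 - q)) u v _ hu hv
      rw [abs_neg, abs_one, abs_mul, hea, abs_of_nonneg (show 0 ≤ p0 - q by omega)] at hl
      have hw := wbound p0 (-1 * u + e * (p0 - q) * v) (w + e * v) d n hn h1 h2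
        (by rw [hq] at h3; linear_combination h3) (by omega) (by rw [ha]; nlinarith)
      have e2 : v + e * w = e * (w + e * v) := by linear_combination (-v) * hee
      rw [e2, abs_mul, hea, one_mul]; exact hw
  refine descent p0 p1 (by omega) (fun n u v => |u| ≤ n ∧ |v| ≤ n ∧ |u + e * v| ≤ n)
    (fun n u v => |u| ≤ n + 1 ∧ |v| ≤ n ∧ |u + e * v| ≤ n) ?_ ?_ ?_ (|u| + |v|).toNat u v ?_
  · rintro u v ⟨a, b, _⟩
    refine box p0 p1 (by omega) ?_ (by omega) u v a b
    have : |p1| = q := by rw [hq, abs_mul, hea, one_mul, abs_of_nonneg (by omega)]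
    rcases h with h | ⟨rfl, h⟩
    · left; omega
    · right; left; omega
  · rintro n u v w d hn a1 a2 a3 ⟨b1, b2, b3⟩
    exact ⟨b2, key n u v w d hn a1 a2 a3 b1 b2 b3⟩
  · rintro n u v w d hn a1 a2 a3 ⟨b1, b2, b3⟩
    exact ⟨b2, key n u v w d hn a1 a2 a3 b1 (by omega) (by omega)⟩
  · have := abs_nonneg u
    have := abs_nonneg v
    have h4 : |u + e * v| ≤ |u| + |v| := by
      calc _ ≤ |u| + |e * v| := abs_add_le _ _
        _ = _ := by rw [abs_mul, hea, one_mul]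
    refine ⟨?_, ?_, ?_⟩ <;> omega

/-- fuel check for the finitely many small cases, `p0 > 0` -/
def chk (p0 p1 : ℤ) : ℕ → ℤ → ℤ → Bool
  | 0, u, v => decide (u = 0 ∧ v = 0)
  | n + 1, u, v => decide (u = 0 ∧ v = 0) ||
      chk p0 p1 n v ((2 * (-(u + p1 * v)) + p0) / (2 * p0))

lemma chk_good (p0 p1 : ℤ) (hp : 2 ≤ p0) (n : ℕ) : ∀ u v, chk p0 p1 n u v = true →
    Good p0 p1 u v := by
  have ha : |p0| = p0 := abs_of_pos (by omega)
  induction n with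
  | zero =>
    intro u v h
    simp only [chk, decide_eq_true_eq] at h
    rw [h.1, h.2]; exact Good.zero
  | succ n ih =>
    intro u v h
    simp only [chk, Bool.or_eq_true, decide_eq_true_eq] at h
    rcases h with h | h
    · rw [h.1, h.2]; exact Good.zero
    · have h1 := Int.emod_add_mul_ediv (2 * (-(u + p1 * v)) + p0) (2 * p0)
      have h2 := Int.emod_nonneg (2 * (-(u + p1 * v)) + p0) (b := 2 * p0) (by omega)
      have h3 := Int.emod_lt_of_pos (2 * (-(u + p1 * v)) + p0) (b := 2 * p0) (by omega)
      set w := (2 * (-(u + p1 * v)) + p0) / (2 * p0)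
      refine Good.step u v w (-(u + p1 * v) - p0 * w) ?_ ?_ (by ring) (ih _ _ h)
      · rw [ha]; linarith
      · rw [ha]; linarith

lemma suff_small (p0 p1 : ℤ) (h : (p0 = 2 ∧ -1 ≤ p1 ∧ p1 ≤ 2) ∨ (p0 = 3 ∧ -2 ≤ p1 ∧ p1 ≤ 2) ∨
    (p0 = 4 ∧ -2 ≤ p1 ∧ p1 ≤ 3)) (u v : ℤ) : Good p0 p1 u v := by
  have hD : 4 ≤ 4 * p0 - p1 * p1 := by
    rcases h with ⟨rfl, a, b⟩ | ⟨rfl, a, b⟩ | ⟨rfl, a, b⟩ <;> interval_cases p1 <;> norm_num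
  have hp2 : 2 ≤ p0 := by omega
  have hp4 : p0 ≤ 4 := by omega
  have ha : |p0| = p0 := abs_of_pos (by omega)
  have hQ : ∀ u v : ℤ, 4 * (u * u + p1 * u * v + p0 * v * v)
      = (2 * u + p1 * v) ^ 2 + (4 * p0 - p1 * p1) * v ^ 2 := by intros; ring
  have hQ' : ∀ u v : ℤ, 4 * p0 * (u * u + p1 * u * v + p0 * v * v)
      = (2 * p0 * v + p1 * u) ^ 2 + (4 * p0 - p1 * p1) * u ^ 2 := by intros; ring
  have hQ0 : ∀ u v : ℤ, 0 ≤ u * u + p1 * u * v + p0 * v * v := by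
    intro u v
    nlinarith [hQ u v, sq_nonneg (2 * u + p1 * v), mul_nonneg (show 0 ≤ 4 * p0 - p1 * p1 by omega) (sq_nonneg v)]
  have main : ∀ n : ℕ, ∀ u v : ℤ, u * u + p1 * u * v + p0 * v * v ≤ 5 + n → Good p0 p1 u v := by
    intro n
    induction n with
    | zero =>
      intro u v hb
      have hb : u * u + p1 * u * v + p0 * v * v ≤ 5 := by simpa using hb
      have hv : v ^ 2 ≤ 5 := by
        nlinarith [hQ u v, sq_nonneg (2 * u + p1 * v), mul_nonneg (show 0 ≤ 4 * p0 - p1 * p1 - 4 by omega) (sq_nonneg v)]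
      have hu : u ^ 2 ≤ 20 := by
        nlinarith [hQ' u v, sq_nonneg (2 * p0 * v + p1 * u), mul_nonneg (show 0 ≤ 4 * p0 - p1 * p1 - 4 by omega) (sq_nonneg u),
          mul_nonneg (show 0 ≤ p0 by omega) (show 0 ≤ 5 - (u * u + p1 * u * v + p0 * v * v) by omega)]
      have v1 : -2 ≤ v := by nlinarith
      have v2 : v ≤ 2 := by nlinarith
      have u1 : -4 ≤ u := by nlinarith
      have u2 : u ≤ 4 := by nlinarith
      clear hb hv hu hQ hQ' hQ0 hD ha hp4
      apply chk_good p0 p1 hp2 20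
      rcases h with ⟨rfl, a, b⟩ | ⟨rfl, a, b⟩ | ⟨rfl, a, b⟩ <;> interval_cases p1 <;>
        interval_cases v <;> interval_cases u <;> decide
    | succ n ih =>
      intro u v hb
      by_cases hc : u * u + p1 * u * v + p0 * v * v ≤ 5 + n
      · exact ih u v hc
      obtain ⟨w, d, a1, a2, a3⟩ := ex_step p0 p1 (by omega) u v
      refine Good.step u v w d a1 a2 a3 (ih v w ?_)
      rw [ha] at a1 a2
      have e : p0 * (v * v + p1 * v * w + p0 * w * w) = (u * u + p1 * u * v + p0 * v * v)
          + d * (2 * u + p1 * v) + d * d := by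
        have : p0 * w = -(u + p1 * v) - d := by linarith
        have e' : p0 * (v * v + p1 * v * w + p0 * w * w) = p0 * v * v + p1 * v * (p0 * w) + (p0 * w) ^ 2 := by ring
        rw [e', this]; ring
      set s := 2 * u + p1 * v with hs
      have hsq : s ^ 2 ≤ 4 * (u * u + p1 * u * v + p0 * v * v) := by
        rw [hQ u v]; nlinarith [mul_nonneg (show 0 ≤ 4 * p0 - p1 * p1 by omega) (sq_nonneg v)]
      set Q := u * u + p1 * u * v + p0 * v * v with hQd
      set Q2 := v * v + p1 * v * w + p0 * w * w with hQ2d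
      have hQ6 : 6 ≤ Q := by push_cast at hb; omega
      suffices Q2 < Q by push_cast at hb; omega
      clear_value s Q Q2
      have hs1 : |s| < Q - 1 := abs_lt_of_sq_lt_sq (by nlinarith) (by omega)
      rw [abs_lt] at hs1
      rcases h with ⟨rfl, _, _⟩ | ⟨rfl, _, _⟩ | ⟨rfl, _, _⟩
      · obtain rfl | rfl : d = -1 ∨ d = 0 := by omega
        all_goals linarith
      · obtain rfl | rfl | rfl : d = -1 ∨ d = 0 ∨ d = 1 := by omega
        all_goals linarith
      · obtain rfl | rfl | rfl | rfl : d = -2 ∨ d = -1 ∨ d = 0 ∨ d = 1 := by omega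
        all_goals linarith
  refine main (u * u + p1 * u * v + p0 * v * v).toNat u v ?_
  have := hQ0 u v
  omega

theorem stmt_2 (p0 p1 : ℤ) (hp : 2 ≤ |p0|) :
    IsEpsCNS (1/2) (X ^ 2 + C p1 * X + C p0) ↔
      (Odd |p0| ∧ 3 ≤ |p0| ∧ |p1| ≤ Int.sign p0 + (|p0| - 1) / 2) ∨
      (Even |p0| ∧ 4 ≤ |p0| ∧
        (|p1| ≤ Int.sign p0 - 1 + |p0| / 2 ∨ p1 = 1 + p0 / 2)) ∨
      (p0 = 2 ∧ -1 ≤ p1 ∧ p1 ≤ 2) := by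
  rw [cns_iff p0 p1 hp]
  constructor
  · intro hG
    have nG : ¬ ∃ u v, ¬ Good p0 p1 u v := by push Not; exact hG
    rcases abs_cases p0 with ⟨h, hs⟩ | ⟨h, hs⟩
    · rw [h] at hp ⊢
      rw [Int.sign_eq_one_of_pos (by omega)]
      have n1 : ¬ (p0 < 2 * (p1 - 1)) := fun h => nG (nec_pp p0 p1 hp h)
      have n2 : ¬ (p0 ≤ 2 * (-p1 - 1)) := fun h => nG (nec_pn p0 p1 hp h)
      rcases abs_cases p1 with ⟨h', _⟩ | ⟨h', _⟩ <;> rw [h'] <;> rw [Int.odd_iff, Int.even_iff] <;> omega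
    · rw [h] at hp ⊢
      rw [Int.sign_eq_neg_one_of_neg (by omega)]
      have n1 : ¬ (-p0 ≤ 2 * (p1 + 1)) := fun h => nG (nec_np p0 p1 hp h)
      have n2 : ¬ (-p0 < 2 * (-p1 + 1)) := fun h => nG (nec_nn p0 p1 hp h)
      rcases abs_cases p1 with ⟨h', _⟩ | ⟨h', _⟩ <;> rw [h'] <;> rw [Int.odd_iff, Int.even_iff] <;> omega
  · intro H u v
    rw [Int.odd_iff, Int.even_iff] at H
    rcases abs_cases p0 with ⟨h, hs⟩ | ⟨h, hs⟩
    · rw [h] at hp H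
      rw [Int.sign_eq_one_of_pos (by omega)] at H
      by_cases h5 : 5 ≤ p0
      · by_cases hb : 2 * |p1| ≤ p0
        · exact suff_sup p0 p1 (Or.inl ⟨h5, hb⟩) u v
        · rcases abs_cases p1 with ⟨h', _⟩ | ⟨h', _⟩ <;> rw [h'] at H hb
          · exact suff_hex p0 p1 1 p1 (by simp) h5 (by ring) (by omega) (by omega) (by omega) u v
          · exact suff_hex p0 p1 (-1) (-p1) (by simp) h5 (by ring) (by omega) (by omega) (by omega) u v
      · apply suff_small
        rcases abs_cases p1 with ⟨h', _⟩ | ⟨h', _⟩ <;> rw [h'] at H <;> omega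
    · rw [h] at hp H
      rw [Int.sign_eq_neg_one_of_neg (by omega)] at H
      apply suff_sup
      right
      rcases abs_cases p1 with ⟨h', _⟩ | ⟨h', _⟩ <;> rw [h'] at H ⊢ <;> omega
end

section
/- Let P(x) = x² + p_1 x + p_0 ∈ ℤ[x] with |p_0| ≥ 2 and let ε ∈ [0, 1/|p_0|). Then P is an ε-CNS polynomial if and only if -1 ≤ p_1 ≤ p_0 and p_0 ≥ 2. -/
open Polynomial

def RepC (p0 : ℤ) (P a : Polynomial ℤ) : Prop :=
  ∃ l : ℕ, 0 < l ∧ ∃ dig : ℕ → ℤ, (∀ j < l, 0 ≤ dig j ∧ dig j < |p0|) ∧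
    P ∣ a - ∑ j ∈ Finset.range l, C (dig j) * X ^ j

lemma isEps_iff (p0 p1 : ℤ) (hp : 2 ≤ |p0|) (ε : ℝ) (hε0 : 0 ≤ ε)
    (hε1 : ε < 1 / (|p0| : ℝ)) :
    IsEpsCNS ε (X ^ 2 + C p1 * X + C p0) ↔ ∀ a, RepC p0 (X ^ 2 + C p1 * X + C p0) a := by
  have hc : (X ^ 2 + C p1 * X + C p0 : Polynomial ℤ).coeff 0 = p0 := by simp
  have hpos : (0:ℝ) < |(p0:ℝ)| := by
    have : (2:ℝ) ≤ |(p0:ℝ)| := by exact_mod_cast hp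
    linarith
  have h1 : ε * |(p0:ℝ)| < 1 := by
    have := (lt_div_iff₀ hpos).1 hε1
    exact this
  have h0 : 0 ≤ ε * |(p0:ℝ)| := by positivity
  have key : ∀ d : ℤ, (-(ε * |(p0 : ℝ)|) ≤ (d : ℝ) ∧ (d : ℝ) < (1 - ε) * |(p0 : ℝ)|) ↔
      (0 ≤ d ∧ d < |p0|) := by
    intro d
    constructor
    · rintro ⟨ha, hb⟩
      constructor
      · have : (-1:ℝ) < d := by linarith
        have : (-1:ℤ) < d := by exact_mod_cast this
        omega
      · have : (d:ℝ) < |(p0:ℝ)| := by nlinarith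
        exact_mod_cast this
    · rintro ⟨ha, hb⟩
      have ha' : (0:ℝ) ≤ d := by exact_mod_cast ha
      have hb' : (d:ℝ) + 1 ≤ |(p0:ℝ)| := by exact_mod_cast hb
      constructor <;> nlinarith
  unfold IsEpsCNS RepC
  simp only [hc, key]

/-- the element with coordinates `u, v` -/
noncomputable def EE (p1 u v : ℤ) : Polynomial ℤ := C (-u - p1 * v) + C (-v) * X

lemma rep_step (p0 p1 : ℤ) (u v w d : ℤ) (hd0 : 0 ≤ d) (hd : d < |p0|)
    (h : p0 * w + p1 * v + u = -d)
    (hr : RepC p0 (X ^ 2 + C p1 * X + C p0) (EE p1 v w)) :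
    RepC p0 (X ^ 2 + C p1 * X + C p0) (EE p1 u v) := by
  obtain ⟨l, hl, dig, hdig, q, hq⟩ := hr
  refine ⟨l + 1, by omega, fun j => Nat.casesOn j d dig, ?_, ?_⟩
  · intro j hj
    cases j with
    | zero => exact ⟨hd0, hd⟩
    | succ j => exact hdig j (by omega)
  · rw [Finset.sum_range_succ']
    have hs : ∑ k ∈ Finset.range l, C (dig k) * X ^ (k + 1) =
        X * ∑ k ∈ Finset.range l, C (dig k) * X ^ k := by
      rw [Finset.mul_sum]
      refine Finset.sum_congr rfl fun k _ => ?_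
      ring
    simp only [hs]
    refine ⟨C w + X * q, ?_⟩
    have hu : u = -d - p0 * w - p1 * v := by linarith
    subst hu
    have : ∑ k ∈ Finset.range l, C (dig k) * X ^ k =
      EE p1 v w - (X ^ 2 + C p1 * X + C p0) * q := by rw [← hq]; ring
    rw [this]
    show _ - (_ + C d * X ^ 0) = _
    simp only [EE, map_sub, map_neg, map_mul]
    ring

lemma rep_zero (p0 p1 : ℤ) (hp : 2 ≤ |p0|) :
    RepC p0 (X ^ 2 + C p1 * X + C p0) (EE p1 0 0) := by
  refine ⟨1, one_pos, fun _ => 0, ?_, ?_⟩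
  · intro j _
    constructor
    · simp
    · show (0:ℤ) < |p0|
      omega
  · simp [EE]

lemma quad_monic (p0 p1 : ℤ) : (X ^ 2 + C p1 * X + C p0 : Polynomial ℤ).Monic := by
  monicity!

lemma quad_deg (p0 p1 : ℤ) : (X ^ 2 + C p1 * X + C p0 : Polynomial ℤ).natDegree = 2 := by
  compute_degree!

lemma rep_all (p0 p1 : ℤ) (h : ∀ u v, RepC p0 (X ^ 2 + C p1 * X + C p0) (EE p1 u v))
    (a : Polynomial ℤ) : RepC p0 (X ^ 2 + C p1 * X + C p0) a := by
  set P : Polynomial ℤ := X ^ 2 + C p1 * X + C p0 with hP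
  have hm : P.Monic := quad_monic p0 p1
  have hdeg : (a %ₘ P).natDegree ≤ 1 := by
    have := natDegree_modByMonic_lt a hm (by
      intro h1
      have := quad_deg p0 p1
      rw [← hP, h1] at this
      simp at this)
    have h2 : P.natDegree = 2 := quad_deg p0 p1
    omega
  have hr := Polynomial.eq_X_add_C_of_natDegree_le_one hdeg
  set r1 := (a %ₘ P).coeff 1
  set r0 := (a %ₘ P).coeff 0
  obtain ⟨l, hl, dig, hdig, q, hq⟩ := h (-r0 + p1 * r1) (-r1)
  refine ⟨l, hl, dig, hdig, q + a /ₘ P, ?_⟩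
  have h3 := modByMonic_add_div a P
  have h4 : EE p1 (-r0 + p1 * r1) (-r1) = a %ₘ P := by
    rw [hr, EE]
    simp only [map_sub, map_neg, map_mul, map_add]
    ring
  rw [h4] at hq
  linear_combination hq - h3

lemma not_rep (p0 p1 : ℤ) (hp : 2 ≤ |p0|) (S : ℤ → ℤ → Prop) (h0 : ¬ S 0 0)
    (hS : ∀ u v w d, S u v → 0 ≤ d → d < |p0| → p0 * w + p1 * v + u = -d → S v w)
    (l : ℕ) : ∀ (dig : ℕ → ℤ) (u v : ℤ), S u v → (∀ j < l, 0 ≤ dig j ∧ dig j < |p0|) →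
    ¬ (X ^ 2 + C p1 * X + C p0 : Polynomial ℤ) ∣
      EE p1 u v - ∑ j ∈ Finset.range l, C (dig j) * X ^ j := by
  induction l with
  | zero =>
    intro dig u v hs _ hdvd
    simp only [Finset.range_zero, Finset.sum_empty, sub_zero] at hdvd
    have hz : EE p1 u v = 0 := by
      by_contra hne
      have h1 := Polynomial.natDegree_le_of_dvd hdvd hne
      rw [quad_deg] at h1
      have h2 : (EE p1 u v).natDegree ≤ 1 := by unfold EE; compute_degree!
      omega
    have c0 := congrArg (fun p => p.coeff 0) hz
    have c1 := congrArg (fun p => p.eval 1) hz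
    simp [EE] at c0 c1
    have hv : v = 0 := by linarith
    subst hv
    have : u = 0 := by linarith
    subst this
    exact h0 hs
  | succ l ih =>
    intro dig u v hs hdig hdvd
    obtain ⟨q, hq⟩ := hdvd
    rw [Finset.sum_range_succ'] at hq
    have hsum : ∑ k ∈ Finset.range l, C (dig (k+1)) * X ^ (k + 1) =
        X * ∑ k ∈ Finset.range l, C (dig (k+1)) * X ^ k := by
      rw [Finset.mul_sum]
      refine Finset.sum_congr rfl fun k _ => ?_
      ring
    rw [hsum] at hq
    have c0 := congrArg (fun p => p.eval 0) hq
    simp [EE] at c0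
    have hd := hdig 0 (by omega)
    have heq : p0 * q.eval 0 + p1 * v + u = - dig 0 := by linarith
    have hs' := hS u v _ _ hs hd.1 hd.2 heq
    refine ih (fun j => dig (j+1)) _ _ hs' (fun j hj => hdig (j+1) (by omega)) ⟨q.divX, ?_⟩
    have hqd := Polynomial.divX_mul_X_add q
    rw [Polynomial.coeff_zero_eq_eval_zero] at hqd
    set w := q.eval 0
    have hu : u = -dig 0 - p0 * w - p1 * v := by linarith
    subst hu
    apply mul_left_cancel₀ (X_ne_zero (R := ℤ))
    rw [← hqd] at hq
    simp only [EE, map_sub, map_neg, map_mul] at hq ⊢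
    linear_combination hq

lemma not_rep' (p0 p1 : ℤ) (hp : 2 ≤ |p0|) (S : ℤ → ℤ → Prop) (h0 : ¬ S 0 0)
    (hS : ∀ u v w d, S u v → 0 ≤ d → d < |p0| → p0 * w + p1 * v + u = -d → S v w)
    (u v : ℤ) (hs : S u v) : ¬ RepC p0 (X ^ 2 + C p1 * X + C p0) (EE p1 u v) := by
  rintro ⟨l, _, dig, hdig, hdvd⟩
  exact not_rep p0 p1 hp S h0 hS l dig u v hs hdig hdvd

lemma not_rep_root (p0 p1 : ℤ) (r : ℝ) (hr : 0 < r) (h : r ^ 2 + p1 * r + p0 = 0) :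
    ¬ RepC p0 (X ^ 2 + C p1 * X + C p0) (C (-1)) := by
  rintro ⟨l, _, dig, hdig, q, hq⟩
  have e := congrArg (fun p => p.eval₂ (Int.castRingHom ℝ) r) hq
  simp only [eval₂_sub, eval₂_mul, eval₂_add, eval₂_C, eval₂_X, eval₂_pow, eval₂_finsetSum] at e
  simp only [eq_intCast] at e
  rw [h, zero_mul] at e
  have : 0 ≤ ∑ j ∈ Finset.range l, (dig j : ℝ) * r ^ j := by
    refine Finset.sum_nonneg fun j hj => ?_
    have := (hdig j (Finset.mem_range.1 hj)).1
    have : (0:ℝ) ≤ dig j := by exact_mod_cast this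
    positivity
  push_cast at e
  linarith

lemma exists_root (p0 p1 : ℤ) (h : p0 < 0 ∨ (0 < p0 ∧ 1 + p1 + p0 < 0)) :
    ∃ r : ℝ, 0 < r ∧ r ^ 2 + p1 * r + p0 = 0 := by
  have hdisc : (0:ℤ) ≤ p1 ^ 2 - 4 * p0 := by
    rcases h with h | ⟨h, h'⟩
    · nlinarith [sq_nonneg p1]
    · nlinarith [sq_nonneg (p0 - 1)]
  have hdr : (0:ℝ) ≤ (p1:ℝ) ^ 2 - 4 * p0 := by exact_mod_cast hdisc
  have hs := Real.sq_sqrt hdr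
  have hs0 := Real.sqrt_nonneg ((p1:ℝ) ^ 2 - 4 * p0)
  set s := Real.sqrt ((p1:ℝ) ^ 2 - 4 * p0)
  refine ⟨(-p1 + s) / 2, ?_, by nlinarith⟩
  rcases h with h | ⟨h, h'⟩
  · have h1 : (p0:ℝ) < 0 := by exact_mod_cast h
    have : (p1:ℝ) < s := by
      by_contra hc
      push Not at hc
      nlinarith
    linarith
  · have h1 : (p1:ℝ) < 0 := by exact_mod_cast (by omega : p1 < 0)
    linarith

lemma necess (p0 p1 : ℤ) (hp : 2 ≤ |p0|)
    (h : ∀ a, RepC p0 (X ^ 2 + C p1 * X + C p0) a) : -1 ≤ p1 ∧ p1 ≤ p0 ∧ 2 ≤ p0 := by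
  have hno : ¬ (p0 < 0 ∨ (0 < p0 ∧ 1 + p1 + p0 < 0)) := by
    intro hh
    obtain ⟨r, hr, he⟩ := exists_root p0 p1 hh
    exact not_rep_root p0 p1 r hr he (h _)
  push Not at hno
  have hp0 : 2 ≤ p0 := by
    rw [abs_of_nonneg hno.1] at hp; exact hp
  have hP1 := hno.2 (by omega)
  have habs : |p0| = p0 := abs_of_nonneg hno.1
  refine ⟨?_, ?_, hp0⟩
  · by_contra hc
    push Not at hc
    refine not_rep' p0 p1 hp (fun u v => u = -1 ∧ v = -1) (by simp) ?_ (-1) (-1) ⟨rfl, rfl⟩ (h _)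
    rintro u v w d ⟨rfl, rfl⟩ hd0 hd he
    rw [habs] at hd
    refine ⟨rfl, ?_⟩
    have h1 : w < 0 := by by_contra hw; push Not at hw; nlinarith
    have h2 : -2 < w := by by_contra hw; push Not at hw; nlinarith
    omega
  · by_contra hc
    push Not at hc
    refine not_rep' p0 p1 hp (fun u v => (0 < v ∧ -v ≤ u ∧ u ≤ 0) ∨ (v < 0 ∧ 0 ≤ u ∧ u ≤ -v))
      (by simp) ?_ 0 1 (by simp) (h _)
    rintro u v w d hs hd0 hd he
    rw [habs] at hd
    rcases hs with ⟨h1, h2, h3⟩ | ⟨h1, h2, h3⟩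
    · right
      have : w ≤ -v := by
        by_contra hw; push Not at hw
        nlinarith [mul_le_mul_of_nonneg_right (show p0 + 1 ≤ p1 by omega) h1.le,
          mul_le_mul_of_nonneg_left (show -v + 1 ≤ w by omega) hno.1]
      omega
    · left
      have : -v ≤ w := by
        by_contra hw; push Not at hw
        nlinarith [mul_le_mul_of_nonneg_right (show p0 + 1 ≤ p1 by omega) (show 0 ≤ -v by omega),
          mul_le_mul_of_nonneg_left (show w ≤ -v - 1 by omega) hno.1]
      omega

lemma lin_div (p0 : ℤ) (hp : 2 ≤ p0) (D : ℤ) : ∃ w d : ℤ, 0 ≤ d ∧ d < p0 ∧ D = d + p0 * w ∧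
    (0 ≤ D → 0 ≤ w ∧ 2 * w ≤ D) ∧ (D < 0 → D - 1 ≤ 2 * w ∧ w ≤ -1) := by
  have h1 := Int.emod_nonneg D (show p0 ≠ 0 by omega)
  have h2 := Int.emod_lt_of_pos D (show 0 < p0 by omega)
  have h3 := Int.emod_add_mul_ediv D p0
  refine ⟨D / p0, D % p0, h1, h2, h3.symm, ?_, ?_⟩
  · intro hD
    have : 0 ≤ D / p0 := Int.ediv_nonneg hD (by omega)
    exact ⟨this, by nlinarith⟩
  · intro hD
    have : D / p0 < 0 := by by_contra hc; push Not at hc; nlinarith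
    exact ⟨by nlinarith, by omega⟩

lemma dyn_zero (p0 : ℤ) (hp : 2 ≤ p0) (G : ℤ → ℤ → Prop) (h0 : G 0 0)
    (hG : ∀ u v w d, 0 ≤ d → d < p0 → p0 * w + 0 * v + u = -d → G v w → G u v) (M : ℕ) :
    ∀ u v : ℤ, |u| ≤ M → |v| ≤ M → G u v := by
  have st : ∀ u v, ∃ w, (0 ≤ -u → 0 ≤ w ∧ 2 * w ≤ -u) ∧ (-u < 0 → -u - 1 ≤ 2 * w ∧ w ≤ -1) ∧
      (G v w → G u v) := by
    intro u v
    obtain ⟨w, d, h1, h2, h3, h4, h5⟩ := lin_div p0 hp (-u)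
    exact ⟨w, h4, h5, hG u v w d h1 h2 (by linarith)⟩
  induction M with
  | zero =>
    intro u v hu hv
    simp at hu hv
    subst hu hv
    exact h0
  | succ M ih =>
    intro u v hu hv
    push_cast at hu hv
    rw [abs_le] at hu hv
    obtain ⟨a, a1, a2, ha⟩ := st u v
    obtain ⟨b, b1, b2, hb⟩ := st v a
    obtain ⟨c, c1, c2, hc⟩ := st a b
    obtain ⟨e, e1, e2, he⟩ := st b c
    exact ha (hb (hc (he (ih c e (abs_le.2 (by omega)) (abs_le.2 (by omega))))))

lemma dyn_neg (p0 : ℤ) (hp : 2 ≤ p0) (G : ℤ → ℤ → Prop) (h0 : G 0 0)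
    (hG : ∀ u v w d, 0 ≤ d → d < p0 → p0 * w + (-1) * v + u = -d → G v w → G u v) (M : ℕ) :
    ∀ u v : ℤ, |u| ≤ M → |v| ≤ M → G u v := by
  have st : ∀ u v, ∃ w, (0 ≤ v-u → 0 ≤ w ∧ 2 * w ≤ v-u) ∧
      (v-u < 0 → v-u - 1 ≤ 2 * w ∧ w ≤ -1) ∧ (G v w → G u v) := by
    intro u v
    obtain ⟨w, d, h1, h2, h3, h4, h5⟩ := lin_div p0 hp (v-u)
    exact ⟨w, h4, h5, hG u v w d h1 h2 (by linarith)⟩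
  induction M with
  | zero =>
    intro u v hu hv
    simp at hu hv
    subst hu hv
    exact h0
  | succ M ih =>
    intro u v hu hv
    push_cast at hu hv
    rw [abs_le] at hu hv
    obtain ⟨a, a1, a2, ha⟩ := st u v
    obtain ⟨b, b1, b2, hb⟩ := st v a
    obtain ⟨c, c1, c2, hc⟩ := st a b
    obtain ⟨e, e1, e2, he⟩ := st b c
    obtain ⟨f, f1, f2, hf⟩ := st c e
    obtain ⟨g, g1, g2, hg⟩ := st e f
    exact ha (hb (hc (he (hf (hg (ih f g (abs_le.2 (by omega)) (abs_le.2 (by omega))))))))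

lemma dyn_pos (p0 p1 : ℤ) (hp : 2 ≤ p0) (h1 : 1 ≤ p1) (h2 : p1 ≤ p0)
    (G : ℤ → ℤ → Prop) (h0 : G 0 0)
    (hG : ∀ u v w d, 0 ≤ d → d < p0 → p0 * w + p1 * v + u = -d → G v w → G u v) (S : ℕ) :
    ∀ (V : ℕ) (c0 c1 c2 u v : ℤ), 0 ≤ c0 → 0 ≤ c1 → 0 ≤ c2 → c0 + c1 + c2 = S →
      v = p1 * c2 - c1 → u = p0 * c2 - c0 - p1 * v →
      (p0 + 1) * (u ^ 2 + v ^ 2) + 2 * p1 * u * v = V → G u v := by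
  have step : ∀ c0 c1 c2 u v : ℤ, 0 ≤ c0 → 0 ≤ c1 → 0 ≤ c2 →
      v = p1 * c2 - c1 → u = p0 * c2 - c0 - p1 * v →
      ∃ c0' c1' c2' w d : ℤ, 0 ≤ c0' ∧ 0 ≤ c1' ∧ 0 ≤ c2' ∧ 0 ≤ d ∧
        c0' + c1' + c2' = c0 + c1 + c2 - d ∧ w = p1 * c2' - c1' ∧ v = p0 * c2' - c0' - p1 * w ∧
        p0 * w + p1 * v + u = -d ∧ (G v w → G u v) := by
    intro c0 c1 c2 u v k0 k1 k2 hv hu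
    have e1 := Int.emod_nonneg c0 (show p0 ≠ 0 by omega)
    have e2 := Int.emod_lt_of_pos c0 (show 0 < p0 by omega)
    have e3 := Int.emod_add_mul_ediv c0 p0
    have e4 : 0 ≤ c0 / p0 := Int.ediv_nonneg k0 (by omega)
    set τ := c0 / p0
    set d := c0 % p0
    have m1 : 0 ≤ (p0 - p1) * τ := mul_nonneg (by omega) e4
    have m2 : 0 ≤ (p1 - 1) * τ := mul_nonneg (by omega) e4
    have hh : p0 * (τ - c2) + p1 * v + u = -d := by rw [hu]; linarith
    refine ⟨c1 + (p0 - p1) * τ, c2 + (p1 - 1) * τ, τ, τ - c2, d, by omega, by omega, e4, e1,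
      by linarith, by ring, by rw [hv]; ring, hh, hG _ _ _ _ e1 e2 hh⟩
  have hVnn : ∀ u v : ℤ, 0 ≤ (p0 + 1) * (u ^ 2 + v ^ 2) + 2 * p1 * u * v := by
    intro u v
    nlinarith [mul_nonneg (show 0 ≤ p1 by omega) (sq_nonneg (u + v)),
      mul_nonneg (show 0 ≤ p0 + 1 - p1 by omega) (add_nonneg (sq_nonneg u) (sq_nonneg v))]
  have hdec : ∀ u v w : ℤ, p0 * w + p1 * v + u = 0 →
      (p0 + 1) * (v ^ 2 + w ^ 2) + 2 * p1 * v * w =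
      (p0 + 1) * (u ^ 2 + v ^ 2) + 2 * p1 * u * v - (p0 - 1) * (w - u) ^ 2 := by
    intro u v w h
    linear_combination (2 * (w - u)) * h
  induction S using Nat.strong_induction_on with
  | _ S ihS =>
  intro V
  induction V using Nat.strong_induction_on with
  | _ V ihV =>
  intro c0 c1 c2 u v k0 k1 k2 hsum hv hu hV
  obtain ⟨a0, a1, a2, w, d, ka0, ka1, ka2, kd, hsa, hw, hva, hrec, himp⟩ :=
    step c0 c1 c2 u v k0 k1 k2 hv hu
  apply himp
  have hV1 := hVnn v w
  by_cases hd : d = 0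
  swap
  · exact ihS (a0 + a1 + a2).toNat (by omega) _ a0 a1 a2 v w ka0 ka1 ka2 (by omega) hw hva
      (Int.toNat_of_nonneg hV1).symm
  subst hd
  have hD := hdec u v w (by simpa using hrec)
  by_cases hwu : w = u
  swap
  · have hpos : 0 < (p0 - 1) * (w - u) ^ 2 :=
      mul_pos (by omega) (by have : w - u ≠ 0 := sub_ne_zero.2 hwu
                             positivity)
    exact ihV ((p0 + 1) * (v ^ 2 + w ^ 2) + 2 * p1 * v * w).toNat (by omega)
      a0 a1 a2 v w ka0 ka1 ka2 (by omega) hw hva (Int.toNat_of_nonneg hV1).symm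
  obtain ⟨b0, b1, b2, y, d, kb0, kb1, kb2, kd, hsb, hy, hwb, hrec2, himp2⟩ :=
    step a0 a1 a2 v w ka0 ka1 ka2 hw hva
  apply himp2
  have hV2 := hVnn w y
  by_cases hd : d = 0
  swap
  · exact ihS (b0 + b1 + b2).toNat (by omega) _ b0 b1 b2 w y kb0 kb1 kb2 (by omega) hy hwb
      (Int.toNat_of_nonneg hV2).symm
  subst hd
  have hD2 := hdec v w y (by simpa using hrec2)
  have hz : (p0 - 1) * (w - u) ^ 2 = 0 := by rw [hwu]; ring
  by_cases hyv : y = v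
  swap
  · have hpos : 0 < (p0 - 1) * (y - v) ^ 2 :=
      mul_pos (by omega) (by have : y - v ≠ 0 := sub_ne_zero.2 hyv
                             positivity)
    exact ihV ((p0 + 1) * (w ^ 2 + y ^ 2) + 2 * p1 * w * y).toNat (by omega)
      b0 b1 b2 w y kb0 kb1 kb2 (by omega) hy hwb (Int.toNat_of_nonneg hV2).symm
  clear ihS ihV step
  subst hwu hyv
  have f1 : (p0 + 1 - p1) * (w - y) = 0 := by linear_combination hrec - hrec2
  have f2 : w - y = 0 := by
    rcases mul_eq_zero.1 f1 with h | h
    · omega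
    · exact h
  have f3 : w = y := by omega
  subst f3
  have f4 : (p0 + 1 + p1) * w = 0 := by linear_combination hrec
  have f5 : w = 0 := by
    rcases mul_eq_zero.1 f4 with h | h
    · omega
    · exact h
  subst f5
  exact h0

lemma suff (p0 p1 : ℤ) (h1 : -1 ≤ p1) (h2 : p1 ≤ p0) (hp : 2 ≤ p0) :
    ∀ u v, RepC p0 (X ^ 2 + C p1 * X + C p0) (EE p1 u v) := by
  have habs : |p0| = p0 := abs_of_nonneg (by omega)
  have h0 := rep_zero p0 p1 (by omega)
  have hG : ∀ u v w d, 0 ≤ d → d < p0 → p0 * w + p1 * v + u = -d →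
      RepC p0 (X ^ 2 + C p1 * X + C p0) (EE p1 v w) →
      RepC p0 (X ^ 2 + C p1 * X + C p0) (EE p1 u v) := fun u v w d a b c e =>
    rep_step p0 p1 u v w d a (by omega) c e
  intro u v
  by_cases hpos : 1 ≤ p1
  · have q1 := abs_nonneg v
    have q2 := abs_nonneg (u + p1 * v)
    have q3 := le_abs_self v
    have q4 := le_abs_self (u + p1 * v)
    set c2 := |v| + |u + p1 * v|
    have r1 : c2 ≤ p1 * c2 := by nlinarith
    have r2 : c2 ≤ p0 * c2 := by nlinarith
    have hVnn : 0 ≤ (p0 + 1) * (u ^ 2 + v ^ 2) + 2 * p1 * u * v := by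
      nlinarith [mul_nonneg (show 0 ≤ p1 by omega) (sq_nonneg (u + v)),
        mul_nonneg (show 0 ≤ p0 + 1 - p1 by omega) (add_nonneg (sq_nonneg u) (sq_nonneg v))]
    have g0 : 0 ≤ p0 * c2 - (u + p1 * v) := by omega
    have g1 : 0 ≤ p1 * c2 - v := by omega
    exact dyn_pos p0 p1 hp hpos h2 (fun u v => RepC p0 (X ^ 2 + C p1 * X + C p0) (EE p1 u v))
      h0 hG (p0 * c2 - (u + p1 * v) + (p1 * c2 - v) + c2).toNat _
      (p0 * c2 - (u + p1 * v)) (p1 * c2 - v) c2 u v g0 g1 (by omega)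
      (Int.toNat_of_nonneg (by omega)).symm (by ring) (by ring) (Int.toNat_of_nonneg hVnn).symm
  · have hc : p1 = 0 ∨ p1 = -1 := by omega
    have b1 : |u| ≤ ((u.natAbs + v.natAbs : ℕ) : ℤ) := by
      push_cast; linarith [abs_nonneg v]
    have b2 : |v| ≤ ((u.natAbs + v.natAbs : ℕ) : ℤ) := by
      push_cast; linarith [abs_nonneg u]
    rcases hc with rfl | rfl
    · exact dyn_zero p0 hp (fun u v => RepC p0 (X ^ 2 + C 0 * X + C p0) (EE 0 u v))
        h0 hG _ u v b1 b2
    · exact dyn_neg p0 hp (fun u v => RepC p0 (X ^ 2 + C (-1) * X + C p0) (EE (-1) u v))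
        h0 hG _ u v b1 b2

theorem stmt_5 (p0 p1 : ℤ) (hp : 2 ≤ |p0|) (ε : ℝ) (hε0 : 0 ≤ ε)
    (hε1 : ε < 1 / (|p0| : ℝ)) :
    IsEpsCNS ε (X ^ 2 + C p1 * X + C p0) ↔ -1 ≤ p1 ∧ p1 ≤ p0 ∧ 2 ≤ p0 := by
  rw [isEps_iff p0 p1 hp ε hε0 hε1]
  constructor
  · exact necess p0 p1 hp
  · rintro ⟨h1, h2, h3⟩ a
    exact rep_all p0 p1 (suff p0 p1 h1 h2 h3) a
end

section
/- For every ε ∈ [0,1), the set B(ε) is contained in D⁰_{2,ε}. -/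
/-- The map `τ_{r,ε}(z₁,z₂) = (z₂, -⌊r₁z₁ + r₂z₂ + ε⌋)`. -/
noncomputable def tau2 (r : ℝ × ℝ) (ε : ℝ) (z : ℤ × ℤ) : ℤ × ℤ :=
  (z.2, -⌊r.1 * (z.1 : ℝ) + r.2 * (z.2 : ℝ) + ε⌋)

/-- `D⁰_{2,ε}`: the set of `r ∈ ℝ²` such that every orbit of `τ_{r,ε}` reaches `(0,0)`. -/
def SRS2 (ε : ℝ) : Set (ℝ × ℝ) :=
  {r | ∀ z : ℤ × ℤ, ∃ k : ℕ, (tau2 r ε)^[k] z = (0, 0)}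

/-- The set `B(ε)`. -/
def Bset (ε : ℝ) : Set (ℝ × ℝ) :=
  {q | (ε < 1/2 ∧ -q.1 - ε ≤ q.2 ∧ q.2 < q.1 + 1 - ε ∧
          -ε ≤ q.1 ∧ q.1 ≤ 2/3 - ε) ∨
       (1/2 ≤ ε ∧ -q.1 - 1 + ε < q.2 ∧ q.2 ≤ q.1 + ε ∧
          -(1 - ε) < q.1 ∧ q.1 ≤ 2/3 - (1 - ε))}

def RZ (x y ε : ℝ) (a b : ℤ) : Prop := ∃ k : ℕ, (tau2 (x, y) ε)^[k] (a, b) = (0, 0)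

lemma RZ_zero (x y ε : ℝ) : RZ x y ε 0 0 := ⟨0, rfl⟩

lemma RZ_step {x y ε : ℝ} {a b : ℤ}
    (h : ∀ c : ℤ, 0 ≤ x * a + y * b + c + ε → x * a + y * b + c + ε < 1 → RZ x y ε b c) :
    RZ x y ε a b := by
  obtain ⟨k, hk⟩ := h (-⌊x * a + y * b + ε⌋)
    (by push_cast; linarith [Int.floor_le (x * a + y * b + ε)])
    (by push_cast; linarith [Int.lt_floor_add_one (x * a + y * b + ε)])
  exact ⟨k + 1, hk⟩

/-- closed under both roundings -/
def Closed2 (x y : ℝ) (V : Set (ℤ × ℤ)) : Prop :=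
  ((0, 1) ∈ V ∧ (0, -1) ∈ V ∧ (1, 0) ∈ V ∧ (-1, 0) ∈ V) ∧
  ∀ a b c : ℤ, (a, b) ∈ V → x * a + y * b + c < 1 → -1 < x * a + y * b + c → (b, c) ∈ V

lemma witness_iter {x y ε : ℝ} {V : Set (ℤ × ℤ)} (hV : Closed2 x y V) (k : ℕ) :
    ∀ z w : ℤ × ℤ, w ∈ V →
      ∃ w' ∈ V, (tau2 (x, y) ε)^[k] (z + w) = (tau2 (x, y) ε)^[k] z + w' := by
  induction k with
  | zero => intro z w hw; exact ⟨w, hw, rfl⟩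
  | succ k ih =>
    intro z w hw
    rw [Function.iterate_succ_apply, Function.iterate_succ_apply]
    obtain ⟨a, b⟩ := z
    obtain ⟨p, q⟩ := w
    set c : ℤ := ⌊x * a + y * b + ε⌋ - ⌊x * (a + p : ℤ) + y * (b + q : ℤ) + ε⌋ with hc
    have h1 : tau2 (x, y) ε ((a, b) + (p, q)) = tau2 (x, y) ε (a, b) + (q, c) := by
      simp only [tau2, Prod.mk_add_mk, hc]
      ext
      · simp
      · simp; ring
    rw [h1]
    apply ih
    apply hV.2 p q c hw
    · have e1 := Int.floor_le (x * a + y * b + ε)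
      have e2 := Int.lt_floor_add_one (x * (a + p : ℤ) + y * (b + q : ℤ) + ε)
      rw [hc]; push_cast at *; linarith
    · have e1 := Int.floor_le (x * (a + p : ℤ) + y * (b + q : ℤ) + ε)
      have e2 := Int.lt_floor_add_one (x * a + y * b + ε)
      rw [hc]; push_cast at *; linarith

lemma witness_add {x y ε : ℝ} {V : Set (ℤ × ℤ)} (hV : Closed2 x y V)
    (hR : ∀ a b, (a, b) ∈ V → RZ x y ε a b) {a b p q : ℤ} (h : RZ x y ε a b)
    (hw : (p, q) ∈ V) : RZ x y ε (a + p) (b + q) := by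
  obtain ⟨k, hk⟩ := h
  obtain ⟨⟨p', q'⟩, hw', e⟩ := witness_iter (ε := ε) hV k (a, b) (p, q) hw
  obtain ⟨l, hl⟩ := hR p' q' hw'
  refine ⟨l + k, ?_⟩
  rw [Function.iterate_add_apply]
  rw [hk] at e
  have : ((a + p, b + q) : ℤ × ℤ) = (a, b) + (p, q) := rfl
  rw [this, e]
  simpa using hl

lemma witness {x y ε : ℝ} {V : Set (ℤ × ℤ)} (hV : Closed2 x y V)
    (hR : ∀ a b, (a, b) ∈ V → RZ x y ε a b) (a b : ℤ) : RZ x y ε a b := by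
  obtain ⟨h1, h2, h3, h4⟩ := hV.1
  have A : ∀ a : ℤ, RZ x y ε a 0 := by
    intro a
    induction a using Int.induction_on with
    | zero => exact RZ_zero _ _ _
    | succ i ih => simpa using witness_add hV hR ih h3
    | pred i ih => simpa [sub_eq_add_neg] using witness_add hV hR ih h4
  induction b using Int.induction_on with
  | zero => exact A a
  | succ i ih => simpa using witness_add hV hR ih h1
  | pred i ih => simpa [sub_eq_add_neg] using witness_add hV hR ih h2

/-- small step lemma with bounded range -/
lemma RZ_step2 {x y ε : ℝ} {a b : ℤ}
    (hl : -2 ≤ x * a + y * b + ε) (hu : x * a + y * b + ε < 3)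
    (h0 : 0 ≤ x * a + y * b + ε → x * a + y * b + ε < 1 → RZ x y ε b 0)
    (h1 : 0 ≤ x * a + y * b + 1 + ε → x * a + y * b + 1 + ε < 1 → RZ x y ε b 1)
    (h2 : 0 ≤ x * a + y * b + 2 + ε → x * a + y * b + 2 + ε < 1 → RZ x y ε b 2)
    (h3 : 0 ≤ x * a + y * b - 1 + ε → x * a + y * b - 1 + ε < 1 → RZ x y ε b (-1))
    (h4 : 0 ≤ x * a + y * b - 2 + ε → x * a + y * b - 2 + ε < 1 → RZ x y ε b (-2)) :
    RZ x y ε a b := by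
  apply RZ_step
  intro c c1 c2
  have l : -3 < c := by
    have : (-3 : ℝ) < c := by linarith
    exact_mod_cast this
  have u : c < 3 := by
    have : (c : ℝ) < 3 := by linarith
    exact_mod_cast this
  have : c = -2 ∨ c = -1 ∨ c = 0 ∨ c = 1 ∨ c = 2 := by omega
  rcases this with rfl | rfl | rfl | rfl | rfl
  · push_cast at c1 c2; apply h4 <;> linarith
  · push_cast at c1 c2; apply h3 <;> linarith
  · push_cast at c1 c2; apply h0 <;> linarith
  · push_cast at c1 c2; apply h1 <;> linarith
  · push_cast at c1 c2; apply h2 <;> linarith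

lemma RZ_step5 {x y ε : ℝ} {a b : ℤ}
    (hl : -5 ≤ x * a + y * b + ε) (hu : x * a + y * b + ε < 6)
    (h0 : 0 ≤ x * a + y * b + (-5) + ε → x * a + y * b + (-5) + ε < 1 → RZ x y ε b (-5))
    (h1 : 0 ≤ x * a + y * b + (-4) + ε → x * a + y * b + (-4) + ε < 1 → RZ x y ε b (-4))
    (h2 : 0 ≤ x * a + y * b + (-3) + ε → x * a + y * b + (-3) + ε < 1 → RZ x y ε b (-3))
    (h3 : 0 ≤ x * a + y * b + (-2) + ε → x * a + y * b + (-2) + ε < 1 → RZ x y ε b (-2))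
    (h4 : 0 ≤ x * a + y * b + (-1) + ε → x * a + y * b + (-1) + ε < 1 → RZ x y ε b (-1))
    (h5 : 0 ≤ x * a + y * b + 0 + ε → x * a + y * b + 0 + ε < 1 → RZ x y ε b 0)
    (h6 : 0 ≤ x * a + y * b + 1 + ε → x * a + y * b + 1 + ε < 1 → RZ x y ε b 1)
    (h7 : 0 ≤ x * a + y * b + 2 + ε → x * a + y * b + 2 + ε < 1 → RZ x y ε b 2)
    (h8 : 0 ≤ x * a + y * b + 3 + ε → x * a + y * b + 3 + ε < 1 → RZ x y ε b 3)
    (h9 : 0 ≤ x * a + y * b + 4 + ε → x * a + y * b + 4 + ε < 1 → RZ x y ε b 4)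
    (h10 : 0 ≤ x * a + y * b + 5 + ε → x * a + y * b + 5 + ε < 1 → RZ x y ε b 5) :
    RZ x y ε a b := by
  apply RZ_step
  intro c c1 c2
  have l : -6 < c := by
    have : (-6 : ℝ) < c := by linarith
    exact_mod_cast this
  have u : c < 6 := by
    have : (c : ℝ) < 6 := by linarith
    exact_mod_cast this
  interval_cases c <;> push_cast at c1 c2
  · exact h0 c1 c2
  · exact h1 c1 c2
  · exact h2 c1 c2
  · exact h3 c1 c2
  · exact h4 c1 c2
  · exact h5 c1 c2
  · exact h6 c1 c2
  · exact h7 c1 c2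
  · exact h8 c1 c2
  · exact h9 c1 c2
  · exact h10 c1 c2

set_option maxHeartbeats 0 in
lemma V9_term {x y ε : ℝ} (e0 : 0 ≤ ε) (e1 : ε < 1/2) (b1 : -x - ε ≤ y) (b2 : y < x + 1 - ε)
    (b3 : -ε ≤ x) (b4 : x ≤ 2/3 - ε) (c1 : x + y ≤ 1) (c2 : x - y ≤ 1) :
    ∀ a b : ℤ, -1 ≤ a → a ≤ 1 → -1 ≤ b → b ≤ 1 → RZ x y ε a b := by
  suffices r0 : RZ x y ε 1 0
  suffices r1 : RZ x y ε (-1) 0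
  suffices r2 : RZ x y ε (-1) 1
  suffices r3 : RZ x y ε (-1) (-1)
  suffices r4 : RZ x y ε 0 (-1)
  suffices r5 : RZ x y ε 1 (-1)
  suffices r6 : RZ x y ε 1 1
  suffices r7 : RZ x y ε 0 1
  · have r99 := RZ_zero x y ε
    intro a b h1 h2 h3 h4
    interval_cases a <;> interval_cases b <;> assumption
  all_goals
    repeat' (first
      | assumption
      | exact RZ_zero _ _ _
      | (refine RZ_step2 ?_ ?_ ?_ ?_ ?_ ?_ ?_ <;> (try push_cast) <;>
          (try (first | (intro i1 i2; exfalso; linarith) | linarith)) <;> intro i1 i2))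

set_option maxHeartbeats 0 in
lemma V7_term {x y ε : ℝ} (e0 : 0 ≤ ε) (e1 : ε < 1/2) (b1 : -x - ε ≤ y) (b2 : y < x + 1 - ε)
    (b3 : -ε ≤ x) (b4 : x ≤ 2/3 - ε) (c1 : y ≤ 1) (c2 : x ≤ y) :
    ∀ a b : ℤ, -1 ≤ a → a ≤ 1 → -1 ≤ b → b ≤ 1 → -1 ≤ a + b → a + b ≤ 1 → RZ x y ε a b := by
  suffices r0 : RZ x y ε 1 0
  suffices r1 : RZ x y ε (-1) 1
  suffices r2 : RZ x y ε 0 (-1)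
  suffices r3 : RZ x y ε (-1) 0
  suffices r4 : RZ x y ε 1 (-1)
  suffices r5 : RZ x y ε 0 1
  · have r99 := RZ_zero x y ε
    intro a b h1 h2 h3 h4 h5 h6
    interval_cases a <;> interval_cases b <;> first | assumption | omega
  all_goals
    repeat' (first
      | assumption
      | exact RZ_zero _ _ _
      | (refine RZ_step2 ?_ ?_ ?_ ?_ ?_ ?_ ?_ <;> (try push_cast) <;>
          (try (first | (intro i1 i2; exfalso; linarith) | linarith)) <;> intro i1 i2))

set_option maxHeartbeats 0 in
lemma T1_term {x y ε : ℝ} (e0 : 0 ≤ ε) (e1 : ε < 1/2) (b1 : -x - ε ≤ y) (b2 : y < x + 1 - ε)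
    (b3 : -ε ≤ x) (b4 : x ≤ 2/3 - ε) (c1 : 1 < x + y) (c2 : y ≤ x) :
    ∀ a b : ℤ, -2 ≤ a → a ≤ 2 → -2 ≤ b → b ≤ 2 → -3 ≤ a + b → a + b ≤ 3 → RZ x y ε a b := by
  suffices r0 : RZ x y ε 1 0
  suffices r1 : RZ x y ε 0 1
  suffices r2 : RZ x y ε (-1) 0
  suffices r3 : RZ x y ε 1 (-1)
  suffices r4 : RZ x y ε 1 1
  suffices r5 : RZ x y ε (-2) 1
  suffices r6 : RZ x y ε (-1) 1
  suffices r7 : RZ x y ε 0 (-1)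
  suffices r8 : RZ x y ε 1 (-2)
  suffices r9 : RZ x y ε 2 (-1)
  suffices r10 : RZ x y ε 2 0
  suffices r11 : RZ x y ε (-1) 2
  suffices r12 : RZ x y ε (-2) (-1)
  suffices r13 : RZ x y ε (-1) (-1)
  suffices r14 : RZ x y ε 0 2
  suffices r15 : RZ x y ε (-2) 0
  suffices r16 : RZ x y ε 2 (-2)
  suffices r17 : RZ x y ε 1 2
  suffices r18 : RZ x y ε 2 1
  suffices r19 : RZ x y ε (-2) 2
  suffices r20 : RZ x y ε (-1) (-2)
  suffices r21 : RZ x y ε 0 (-2)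
  · have r99 := RZ_zero x y ε
    intro a b h1 h2 h3 h4 h5 h6
    interval_cases a <;> interval_cases b <;> first | assumption | omega
  all_goals
    repeat' (first
      | assumption
      | exact RZ_zero _ _ _
      | (refine RZ_step2 ?_ ?_ ?_ ?_ ?_ ?_ ?_ <;> (try push_cast) <;>
          (try (first | (intro i1 i2; exfalso; linarith) | linarith)) <;> intro i1 i2))

set_option maxHeartbeats 0 in
lemma T2_term {x y ε : ℝ} (e0 : 0 ≤ ε) (e1 : ε < 1/2) (b1 : -x - ε ≤ y) (b2 : y < x + 1 - ε)
    (b3 : -ε ≤ x) (b4 : x ≤ 2/3 - ε) (c1 : 1 < x - y) :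
    ∀ a b : ℤ, -2 ≤ a → a ≤ 2 → -2 ≤ b → b ≤ 2 → -3 ≤ a - b → a - b ≤ 3 → RZ x y ε a b := by
  suffices r0 : RZ x y ε 1 0
  suffices r1 : RZ x y ε 1 1
  suffices r2 : RZ x y ε 0 1
  suffices r3 : RZ x y ε (-1) 0
  suffices r4 : RZ x y ε 0 (-1)
  suffices r5 : RZ x y ε 2 0
  suffices r6 : RZ x y ε 2 1
  suffices r7 : RZ x y ε 1 2
  suffices r8 : RZ x y ε (-2) 1
  suffices r9 : RZ x y ε (-1) 1
  suffices r10 : RZ x y ε (-2) (-1)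
  suffices r11 : RZ x y ε (-1) (-1)
  suffices r12 : RZ x y ε 1 (-1)
  suffices r13 : RZ x y ε 2 2
  suffices r14 : RZ x y ε (-1) 2
  suffices r15 : RZ x y ε 0 2
  suffices r16 : RZ x y ε (-2) 0
  suffices r17 : RZ x y ε (-2) (-2)
  suffices r18 : RZ x y ε (-1) (-2)
  suffices r19 : RZ x y ε 0 (-2)
  suffices r20 : RZ x y ε 1 (-2)
  suffices r21 : RZ x y ε 2 (-1)
  · have r99 := RZ_zero x y ε
    intro a b h1 h2 h3 h4 h5 h6
    interval_cases a <;> interval_cases b <;> first | assumption | omega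
  all_goals
    repeat' (first
      | assumption
      | exact RZ_zero _ _ _
      | (refine RZ_step2 ?_ ?_ ?_ ?_ ?_ ?_ ?_ <;> (try push_cast) <;>
          (try (first | (intro i1 i2; exfalso; linarith) | linarith)) <;> intro i1 i2))

set_option maxHeartbeats 0 in
lemma ED_small {x y ε : ℝ} (e0 : 0 ≤ ε) (e1 : ε < 1/2) (b1 : -x - ε ≤ y) (b2 : y < x + 1 - ε)
    (b3 : -ε ≤ x) (b4 : x ≤ 2/3 - ε) (c1 : 1 < y) :
    RZ x y ε 1 0 ∧ RZ x y ε 2 0 ∧ RZ x y ε 1 1 ∧ RZ x y ε (-1) 0 ∧ RZ x y ε (-2) 0 ∧ RZ x y ε (-1) (-1) := by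
  suffices r0 : RZ x y ε 1 0
  suffices r1 : RZ x y ε (-1) 1
  suffices r2 : RZ x y ε 1 (-1)
  suffices r3 : RZ x y ε 0 1
  suffices r4 : RZ x y ε (-1) 0
  suffices r5 : RZ x y ε 2 (-1)
  suffices r6 : RZ x y ε 3 (-1)
  suffices r7 : RZ x y ε (-2) 1
  suffices r8 : RZ x y ε 2 (-2)
  suffices r9 : RZ x y ε (-1) 2
  suffices r10 : RZ x y ε 0 (-1)
  suffices r11 : RZ x y ε 2 0
  suffices r12 : RZ x y ε (-3) 2
  suffices r13 : RZ x y ε (-2) 2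
  suffices r14 : RZ x y ε 3 (-2)
  suffices r15 : RZ x y ε (-3) 3
  suffices r16 : RZ x y ε 3 (-3)
  suffices r17 : RZ x y ε (-2) 3
  suffices r18 : RZ x y ε 1 (-2)
  suffices r19 : RZ x y ε 1 1
  suffices r20 : RZ x y ε (-3) 1
  suffices r21 : RZ x y ε 0 2
  suffices r22 : RZ x y ε (-2) 0
  suffices r23 : RZ x y ε 2 (-3)
  suffices r24 : RZ x y ε (-1) 3
  suffices r25 : RZ x y ε (-1) (-1)
  · have r99 := RZ_zero x y ε
    refine ⟨?_, ?_, ?_, ?_, ?_, ?_⟩ <;> assumption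
  all_goals
    repeat' (first
      | assumption
      | exact RZ_zero _ _ _
      | (refine RZ_step5 ?_ ?_ ?_ ?_ ?_ ?_ ?_ ?_ ?_ ?_ ?_ ?_ ?_ <;> (try push_cast) <;>
          (try (first | (intro i1 i2; exfalso; linarith) | linarith)) <;> intro i1 i2))

def Box (n m : ℤ) (σ : ℤ) : Set (ℤ × ℤ) :=
  {z | -n ≤ z.1 ∧ z.1 ≤ n ∧ -n ≤ z.2 ∧ z.2 ≤ n ∧ -m ≤ z.1 + σ * z.2 ∧ z.1 + σ * z.2 ≤ m}

lemma Box_finite (n m σ : ℤ) : (Box n m σ).Finite := by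
  apply ((Set.finite_Icc (-n) n).prod (Set.finite_Icc (-n) n)).subset
  rintro ⟨a, b⟩ ⟨h1, h2, h3, h4, -⟩
  exact ⟨⟨h1, h2⟩, ⟨h3, h4⟩⟩

set_option maxHeartbeats 1000000 in
lemma closed_V9 {x y : ℝ} (c1 : x + y ≤ 1) (c2 : x - y ≤ 1) (c3 : -1 ≤ x - y) (c4 : -1 ≤ x + y) :
    Closed2 x y (Box 1 2 1) := by
  refine ⟨by simp [Box], ?_⟩
  rintro a b c ⟨h1, h2, h3, h4, h5, h6⟩ i1 i2
  simp only at h1 h2 h3 h4 h5 h6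
  suffices h : -1 ≤ c ∧ c ≤ 1 by
    obtain ⟨h, h'⟩ := h
    refine ⟨h3, h4, h, h', ?_, ?_⟩ <;> simp only <;> omega
  constructor
  · by_contra hc
    have : (c : ℝ) ≤ -2 := by exact_mod_cast (by omega : c ≤ -2)
    interval_cases a <;> interval_cases b <;> push_cast at i1 i2 <;> linarith
  · by_contra hc
    have : (2 : ℝ) ≤ c := by exact_mod_cast (by omega : 2 ≤ c)
    interval_cases a <;> interval_cases b <;> push_cast at i1 i2 <;> linarith

set_option maxHeartbeats 1000000 in
lemma closed_V7 {x y : ℝ} (c1 : y ≤ 1) (c2 : x ≤ y) (c3 : -1 ≤ x - y) (c4 : 0 ≤ y)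
    (c5 : x ≤ 1) (c6 : -1 ≤ x) :
    Closed2 x y (Box 1 1 1) := by
  refine ⟨by simp [Box], ?_⟩
  rintro a b c ⟨h1, h2, h3, h4, h5, h6⟩ i1 i2
  simp only at h1 h2 h3 h4 h5 h6
  have l : -2 ≤ c := by
    by_contra hc
    have : (c : ℝ) ≤ -3 := by exact_mod_cast (by omega : c ≤ -3)
    interval_cases a <;> interval_cases b <;> push_cast at i1 i2 <;> linarith
  have u : c ≤ 2 := by
    by_contra hc
    have : (3 : ℝ) ≤ c := by exact_mod_cast (by omega : 3 ≤ c)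
    interval_cases a <;> interval_cases b <;> push_cast at i1 i2 <;> linarith
  interval_cases a <;> interval_cases b <;> interval_cases c <;>
    first | (exfalso; revert h5 h6; norm_num; done) | (simp [Box]; done) | (exfalso; push_cast at i1 i2; linarith)

set_option maxHeartbeats 2000000 in
lemma closed_T1 {x y : ℝ} (c1 : 1 < x + y) (c2 : y ≤ x) (c3 : x ≤ 2/3) :
    Closed2 x y (Box 2 3 1) := by
  refine ⟨by simp [Box], ?_⟩
  rintro a b c ⟨h1, h2, h3, h4, h5, h6⟩ i1 i2
  simp only at h1 h2 h3 h4 h5 h6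
  have l : -2 ≤ c := by
    by_contra hc
    have : (c : ℝ) ≤ -3 := by exact_mod_cast (by omega : c ≤ -3)
    interval_cases a <;> interval_cases b <;> push_cast at i1 i2 <;> linarith
  have u : c ≤ 2 := by
    by_contra hc
    have : (3 : ℝ) ≤ c := by exact_mod_cast (by omega : 3 ≤ c)
    interval_cases a <;> interval_cases b <;> push_cast at i1 i2 <;> linarith
  refine ⟨h3, h4, l, u, ?_, ?_⟩
  · simp only
    by_contra hc
    obtain ⟨rfl, rfl⟩ : b = -2 ∧ c = -2 := by omega
    interval_cases a <;> push_cast at i1 i2 <;> linarith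
  · simp only
    by_contra hc
    obtain ⟨rfl, rfl⟩ : b = 2 ∧ c = 2 := by omega
    interval_cases a <;> push_cast at i1 i2 <;> linarith

set_option maxHeartbeats 2000000 in
lemma closed_T2 {x y ε : ℝ} (e0 : 0 ≤ ε) (c1 : 1 < x - y) (c2 : -x - ε ≤ y) (c3 : x ≤ 2/3 - ε) :
    Closed2 x y (Box 2 3 (-1)) := by
  refine ⟨by simp [Box], ?_⟩
  rintro a b c ⟨h1, h2, h3, h4, h5, h6⟩ i1 i2
  simp only at h1 h2 h3 h4 h5 h6
  have l : -2 ≤ c := by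
    by_contra hc
    have : (c : ℝ) ≤ -3 := by exact_mod_cast (by omega : c ≤ -3)
    interval_cases a <;> interval_cases b <;> push_cast at i1 i2 <;> linarith
  have u : c ≤ 2 := by
    by_contra hc
    have : (3 : ℝ) ≤ c := by exact_mod_cast (by omega : 3 ≤ c)
    interval_cases a <;> interval_cases b <;> push_cast at i1 i2 <;> linarith
  refine ⟨h3, h4, l, u, ?_, ?_⟩
  · simp only
    by_contra hc
    obtain ⟨rfl, rfl⟩ : b = -2 ∧ c = 2 := by omega
    interval_cases a <;> push_cast at i1 i2 <;> linarith
  · simp only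
    by_contra hc
    obtain ⟨rfl, rfl⟩ : b = 2 ∧ c = -2 := by omega
    interval_cases a <;> push_cast at i1 i2 <;> linarith

def VE (K : ℤ) : Set (ℤ × ℤ) :=
  {z | -K ≤ z.1 ∧ z.1 ≤ K ∧ -K ≤ z.2 ∧ z.2 ≤ K ∧ -2 ≤ z.1 + z.2 ∧ z.1 + z.2 ≤ 2 ∧
    (z.1 + z.2 = 2 → z.2 ≤ K - 1) ∧ (z.1 + z.2 = -2 → -(K - 1) ≤ z.2)}

lemma VE_finite (K : ℤ) : (VE K).Finite := by
  apply ((Set.finite_Icc (-K) K).prod (Set.finite_Icc (-K) K)).subset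
  rintro ⟨a, b⟩ ⟨h1, h2, h3, h4, -⟩
  exact ⟨⟨h1, h2⟩, ⟨h3, h4⟩⟩

/-- The upper half of the closure computation; `s = a + b`, `t = b + c`. -/
lemma VE_half {x δ : ℝ} {K b s t : ℤ} (hx : x ≤ 2/3) (hd : 0 < δ) (hdx : δ < x) (hK : 3 ≤ K)
    (hA : x ≤ δ * K) (hB : 2 * x - 1 ≤ δ * (K - 2)) (hC : 2 * x + δ * (K - 2) ≤ 2)
    (hD : δ * K ≤ 2) (hE : x + δ * (K - 1) ≤ 2)
    (h4 : b ≤ K) (h4' : b ≤ K + s) (hs1 : -2 ≤ s) (hs2 : s ≤ 2) (hs3 : s = 2 → b ≤ K - 1)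
    (i1 : t + x * s - δ * b < 1) (i2 : -1 < t + x * s - δ * b) :
    t ≤ 2 ∧ (t = -1 → b ≤ K - 1) ∧ (t ≤ -2 → b ≤ K - 3) := by
  have mono : ∀ m n : ℤ, m ≤ n → δ * (m : ℝ) ≤ δ * n := fun m n h =>
    mul_le_mul_of_nonneg_left (by exact_mod_cast h) hd.le
  refine ⟨?_, ?_, ?_⟩
  · by_contra hc
    have ht : (3 : ℝ) ≤ t := by exact_mod_cast (by omega : 3 ≤ t)
    have m0 := mono b K h4
    have m1 := mono b (K + s) h4'
    interval_cases s <;> push_cast at * <;> linarith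
  · rintro rfl
    by_contra hc
    have hb : b = K := by omega
    subst hb
    have : s ≤ 1 := by
      by_contra h
      have := hs3 (by omega)
      omega
    interval_cases s <;> push_cast at * <;> linarith
  · intro ht
    by_contra hc
    have ht : (t : ℝ) ≤ -2 := by exact_mod_cast ht
    have m0 := mono (K - 2) b (by omega)
    have m1 := mono 1 (K - 2) (by omega)
    interval_cases s <;> push_cast at * <;> linarith

lemma closed_VE {x y δ : ℝ} {K : ℤ} (hy : y = x + 1 - δ) (hx : x ≤ 2/3) (hd : 0 < δ) (hdx : δ < x)
    (hK : 3 ≤ K)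
    (hA : x ≤ δ * K) (hB : 2 * x - 1 ≤ δ * (K - 2)) (hC : 2 * x + δ * (K - 2) ≤ 2)
    (hD : δ * K ≤ 2) (hE : x + δ * (K - 1) ≤ 2) : Closed2 x y (VE K) := by
  refine ⟨by simp [VE]; omega, ?_⟩
  rintro a b c ⟨h1, h2, h3, h4, h5, h6, h7, h8⟩ i1 i2
  simp only at h1 h2 h3 h4 h5 h6 h7 h8
  subst hy
  obtain ⟨p1, p2, p3⟩ := VE_half (b := b) (s := a + b) (t := b + c) hx hd hdx hK hA hB hC hD hE
    h4 (by omega) h5 h6 h7 (by push_cast; linarith) (by push_cast; linarith)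
  obtain ⟨q1, q2, q3⟩ := VE_half (b := -b) (s := -(a + b)) (t := -(b + c)) hx hd hdx hK hA hB hC hD
    hE (by omega) (by omega) (by omega) (by omega) (by omega) (by push_cast; linarith)
    (by push_cast; linarith)
  refine ⟨h3, h4, ?_, ?_, ?_, ?_, ?_, ?_⟩ <;> simp only <;> omega

lemma VE_exists {x y : ℝ} (hx : x ≤ 2/3) (hd : y < x + 1) (hdx : 1 < y) :
    ∃ K : ℤ, Closed2 x y (VE K) := by
  obtain ⟨δ, hδ⟩ : ∃ δ, δ = x + 1 - y := ⟨_, rfl⟩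
  have d0 : 0 < δ := by linarith
  have dx : δ < x := by linarith
  set k := ⌊(2 - 2 * x) / δ⌋ with hk
  have k1 : δ * k ≤ 2 - 2 * x := by
    have := Int.floor_le ((2 - 2 * x) / δ)
    rw [le_div_iff₀ d0] at this
    linarith
  have k2 : 2 - 2 * x < δ * k + δ := by
    have := Int.lt_floor_add_one ((2 - 2 * x) / δ)
    rw [div_lt_iff₀ d0] at this
    linarith
  have k3 : 1 ≤ k := by
    rw [hk, Int.le_floor, le_div_iff₀ d0]
    push_cast; linarith
  have k4 : δ * 1 ≤ δ * k := mul_le_mul_of_nonneg_left (by exact_mod_cast k3) d0.le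
  refine ⟨k + 2, closed_VE (δ := δ) (by linarith) hx d0 dx (by omega) ?_ ?_ ?_ ?_ ?_⟩ <;>
    push_cast <;> linarith

lemma VE_term {x y ε : ℝ} (e0 : 0 ≤ ε) (e1 : ε < 1/2) (b1 : -x - ε ≤ y) (b2 : y < x + 1 - ε)
    (b3 : -ε ≤ x) (b4 : x ≤ 2/3 - ε) (c1 : 1 < y) {K : ℤ} (hV : Closed2 x y (VE K)) (a b : ℤ)
    (h : (a, b) ∈ VE K) : RZ x y ε a b := by
  obtain ⟨r1, r2, r3, r4, r5, r6⟩ := ED_small e0 e1 b1 b2 b3 b4 c1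
  obtain ⟨δ, hδ⟩ : ∃ δ, δ = x + 1 - y := ⟨_, rfl⟩
  have d0 : ε < δ := by linarith
  have dx : δ < x := by linarith
  obtain rfl : y = x + 1 - δ := by linarith
  -- stepping in terms of `t = b + c`
  have step : ∀ a b : ℤ, (a, b) ∈ VE K →
      (∀ t : ℤ, (b, t - b) ∈ VE K → -2 ≤ t → t ≤ 2 → 0 ≤ t + x * (a + b : ℤ) - δ * b + ε →
        t + x * (a + b : ℤ) - δ * b + ε < 1 → RZ x (x + 1 - δ) ε b (t - b)) →
      RZ x (x + 1 - δ) ε a b := by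
    intro a b hab H
    apply RZ_step
    intro c i1 i2
    have hm := hV.2 a b c hab (by linarith) (by linarith)
    have := H (b + c) (by simpa using hm) hm.2.2.2.2.1 hm.2.2.2.2.2.1
      (by push_cast; linarith) (by push_cast; linarith)
    simpa using this
  have pos : ∀ b : ℤ, 1 ≤ b → δ ≤ δ * b := fun b hb => by
    have : (1 : ℝ) ≤ b := by exact_mod_cast hb
    nlinarith
  have neg : ∀ b : ℤ, b ≤ -1 → δ * b ≤ -δ := fun b hb => by
    have : (b : ℝ) ≤ -1 := by exact_mod_cast hb
    nlinarith
  have desc : ∀ n : ℕ, (∀ a b : ℤ, (a, b) ∈ VE K → 1 ≤ b → b ≤ n → a + b ≤ 0 →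
      RZ x (x + 1 - δ) ε a b) ∧ (∀ a b : ℤ, (a, b) ∈ VE K → b ≤ -1 → -n ≤ b → 0 ≤ a + b →
      RZ x (x + 1 - δ) ε a b) := by
    intro n
    induction n with
    | zero => exact ⟨fun a b _ h1 h2 => by omega, fun a b _ h1 h2 => by omega⟩
    | succ n ih =>
      have P1 : ∀ a b : ℤ, (a, b) ∈ VE K → 1 ≤ b → b ≤ (n + 1 : ℕ) → a + b ≤ 0 →
          RZ x (x + 1 - δ) ε a b := by
        intro a b hab hb hn hs
        apply step a b hab
        intro t ht t1 t2 i1 i2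
        have hs' : ((a + b : ℤ) : ℝ) ≤ 0 := by exact_mod_cast hs
        have hp := pos b hb
        have t3 : 0 < t := by
          have : (0 : ℝ) < t := by nlinarith
          exact_mod_cast this
        by_cases hc : t - b ≤ -1
        · exact ih.2 b (t - b) ht hc (by omega) (by omega)
        · have : (t = 1 ∧ b = 1) ∨ (t = 2 ∧ b = 2) ∨ (t = 2 ∧ b = 1) := by omega
          rcases this with ⟨rfl, rfl⟩ | ⟨rfl, rfl⟩ | ⟨rfl, rfl⟩ <;> assumption
      refine ⟨P1, ?_⟩
      intro a b hab hb hn hs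
      apply step a b hab
      intro t ht t1 t2 i1 i2
      have hs' : (0 : ℝ) ≤ ((a + b : ℤ) : ℝ) := by exact_mod_cast hs
      have hp := neg b hb
      have t3 : t < 1 := by
        have : (t : ℝ) < 1 := by nlinarith
        exact_mod_cast this
      by_cases hc : 1 ≤ t - b
      · exact P1 b (t - b) ht hc (by omega) (by omega)
      · have : (t = -1 ∧ b = -1) ∨ (t = -2 ∧ b = -2) ∨ (t = -2 ∧ b = -1) := by omega
        rcases this with ⟨rfl, rfl⟩ | ⟨rfl, rfl⟩ | ⟨rfl, rfl⟩ <;> assumption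
  have D1 : ∀ a b : ℤ, (a, b) ∈ VE K → 1 ≤ b → a + b ≤ 0 → RZ x (x + 1 - δ) ε a b :=
    fun a b hab hb hs => (desc b.toNat).1 a b hab hb (by omega) hs
  have D2 : ∀ a b : ℤ, (a, b) ∈ VE K → b ≤ -1 → 0 ≤ a + b → RZ x (x + 1 - δ) ε a b :=
    fun a b hab hb hs => (desc (-b).toNat).2 a b hab hb (by omega) hs
  -- after a step from `b ≥ 1` to `t ≥ 0`
  have Q1 : ∀ b t : ℤ, (b, t - b) ∈ VE K → 1 ≤ b → 0 ≤ t → t ≤ 2 →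
      RZ x (x + 1 - δ) ε b (t - b) := by
    intro b t ht hb h0 h2
    by_cases hc : t - b ≤ -1
    · exact D2 b (t - b) ht hc (by omega)
    · have : (t = 1 ∧ b = 1) ∨ (t = 2 ∧ b = 2) ∨ (t = 2 ∧ b = 1) := by omega
      rcases this with ⟨rfl, rfl⟩ | ⟨rfl, rfl⟩ | ⟨rfl, rfl⟩ <;> assumption
  have Q2 : ∀ b t : ℤ, (b, t - b) ∈ VE K → b ≤ -1 → -2 ≤ t → t ≤ 0 →
      RZ x (x + 1 - δ) ε b (t - b) := by
    intro b t ht hb h0 h2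
    by_cases hc : 1 ≤ t - b
    · exact D1 b (t - b) ht hc (by omega)
    · have : (t = -1 ∧ b = -1) ∨ (t = -2 ∧ b = -2) ∨ (t = -2 ∧ b = -1) := by omega
      rcases this with ⟨rfl, rfl⟩ | ⟨rfl, rfl⟩ | ⟨rfl, rfl⟩ <;> assumption
  have F1 : ∀ a b : ℤ, (a, b) ∈ VE K → 1 ≤ b → a + b = 1 → RZ x (x + 1 - δ) ε a b := by
    intro a b hab hb hs
    apply step a b hab
    intro t ht t1 t2 i1 i2
    have hp := pos b hb
    rw [hs] at i1 i2
    have t3 : -1 < t := by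
      have : (-1 : ℝ) < t := by push_cast at i1; linarith
      exact_mod_cast this
    exact Q1 b t ht hb (by omega) t2
  have C1 : ∀ a b : ℤ, (a, b) ∈ VE K → b ≤ -1 → a + b = -1 → RZ x (x + 1 - δ) ε a b := by
    intro a b hab hb hs
    apply step a b hab
    intro t ht t1 t2 i1 i2
    have hp := neg b hb
    rw [hs] at i1 i2
    have t3 : t < 2 := by
      have : (t : ℝ) < 2 := by push_cast at i2; linarith
      exact_mod_cast this
    by_cases h1 : t = 1
    · exact F1 b (t - b) ht (by omega) (by omega)
    · exact Q2 b t ht hb t1 (by omega)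
  have F2 : ∀ a b : ℤ, (a, b) ∈ VE K → 1 ≤ b → a + b = 2 → RZ x (x + 1 - δ) ε a b := by
    intro a b hab hb hs
    apply step a b hab
    intro t ht t1 t2 i1 i2
    have hp := pos b hb
    rw [hs] at i1 i2
    have t3 : -2 < t := by
      have : (-2 : ℝ) < t := by push_cast at i1; linarith
      exact_mod_cast this
    by_cases h1 : t = -1
    · exact C1 b (t - b) ht (by omega) (by omega)
    · exact Q1 b t ht hb (by omega) t2
  have C2 : ∀ a b : ℤ, (a, b) ∈ VE K → b ≤ -1 → a + b = -2 → RZ x (x + 1 - δ) ε a b := by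
    intro a b hab hb hs
    apply step a b hab
    intro t ht t1 t2 i1 i2
    by_cases h1 : t = 1
    · exact F1 b (t - b) ht (by omega) (by omega)
    by_cases h2 : t = 2
    · exact F2 b (t - b) ht (by omega) (by omega)
    · exact Q2 b t ht hb t1 (by omega)
  have s1 := h.2.2.2.2.1
  have s2 := h.2.2.2.2.2.1
  simp only at s1 s2
  rcases lt_trichotomy b 0 with hb | hb | hb
  · have : 0 ≤ a + b ∨ a + b = -1 ∨ a + b = -2 := by omega
    rcases this with hs | hs | hs
    · exact D2 a b h (by omega) hs
    · exact C1 a b h (by omega) hs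
    · exact C2 a b h (by omega) hs
  · subst hb
    have : a = 0 ∨ a = 1 ∨ a = 2 ∨ a = -1 ∨ a = -2 := by omega
    rcases this with rfl | rfl | rfl | rfl | rfl
    · exact RZ_zero _ _ _
    all_goals assumption
  · have : a + b ≤ 0 ∨ a + b = 1 ∨ a + b = 2 := by omega
    rcases this with hs | hs | hs
    · exact D1 a b h (by omega) hs
    · exact F1 a b h (by omega) hs
    · exact F2 a b h (by omega) hs

def Hyp (x y ε : ℝ) : Prop :=
  0 ≤ ε ∧ ε < 1/2 ∧ -x - ε ≤ y ∧ y < x + 1 - ε ∧ -ε ≤ x ∧ x ≤ 2/3 - ε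

lemma V_exists {x y ε : ℝ} (h : Hyp x y ε) :
    ∃ V : Set (ℤ × ℤ), V.Finite ∧ Closed2 x y V ∧
      ∀ ε', Hyp x y ε' → ∀ a b, (a, b) ∈ V → RZ x y ε' a b := by
  obtain ⟨e0, e1, b1, b2, b3, b4⟩ := h
  by_cases hy : 1 < y
  · obtain ⟨K, hK⟩ := VE_exists (x := x) (y := y) (by linarith) (by linarith) hy
    exact ⟨VE K, VE_finite K, hK, fun ε' ⟨e0, e1, b1, b2, b3, b4⟩ a b hab =>
      VE_term e0 e1 b1 b2 b3 b4 hy hK a b hab⟩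
  · push Not at hy
    by_cases h1 : 1 < x - y
    · exact ⟨_, Box_finite _ _ _, closed_T2 e0 h1 b1 b4,
        fun ε' ⟨e0, e1, b1, b2, b3, b4⟩ a b ⟨h1', h2, h3, h4, h5, h6⟩ =>
        T2_term e0 e1 b1 b2 b3 b4 h1 a b h1' h2 h3 h4 (by simp only at h5; omega)
          (by simp only at h6; omega)⟩
    · push Not at h1
      by_cases h2 : x + y ≤ 1
      · exact ⟨_, Box_finite _ _ _, closed_V9 h2 h1 (by linarith) (by linarith),
          fun ε' ⟨e0, e1, b1, b2, b3, b4⟩ a b ⟨h1', h2', h3, h4, h5, h6⟩ =>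
          V9_term e0 e1 b1 b2 b3 b4 h2 h1 a b h1' h2' h3 h4⟩
      · push Not at h2
        by_cases h3 : x ≤ y
        · exact ⟨_, Box_finite _ _ _, closed_V7 hy h3 (by linarith) (by linarith) (by linarith)
            (by linarith),
            fun ε' ⟨e0, e1, b1, b2, b3, b4⟩ a b ⟨h1', h2', h3', h4, h5, h6⟩ =>
            V7_term e0 e1 b1 b2 b3 b4 hy h3 a b h1' h2' h3' h4 (by simp only at h5; omega)
              (by simp only at h6; omega)⟩
        · push Not at h3
          exact ⟨_, Box_finite _ _ _, closed_T1 h2 h3.le (by linarith),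
            fun ε' ⟨e0, e1, b1, b2, b3, b4⟩ a b ⟨h1', h2', h3', h4, h5, h6⟩ =>
            T1_term e0 e1 b1 b2 b3 b4 h2 h3.le a b h1' h2' h3' h4 (by simp only at h5; omega)
              (by simp only at h6; omega)⟩

/-- mirrored version, by an infinitesimal perturbation of `1 - ε` -/
lemma mirror {x y ε : ℝ} (h0 : 1/2 ≤ ε) (hε : ε < 1) (h1 : -x - 1 + ε < y) (h2 : y ≤ x + ε)
    (h3 : -(1 - ε) < x) (h4 : x ≤ 2/3 - (1 - ε)) (a b : ℤ) : RZ x y ε a b := by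
  -- strict perturbation hypotheses
  have ev : ∀ᶠ η : ℝ in nhdsWithin 0 (Set.Ioi 0), Hyp x y (1 - ε - η) := by
    have m : 0 < min (1 - ε) (min (y + x + 1 - ε) (x + (1 - ε))) :=
      lt_min (by linarith) (lt_min (by linarith) (by linarith))
    filter_upwards [Ioo_mem_nhdsGT m] with η hη
    obtain ⟨n0, n1⟩ := hη
    rw [lt_min_iff, lt_min_iff] at n1
    obtain ⟨n1, n2, n3⟩ := n1
    refine ⟨?_, ?_, ?_, ?_, ?_, ?_⟩ <;> linarith
  obtain ⟨η0, hη0⟩ := ev.exists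
  obtain ⟨V, hf, hV, hR⟩ := V_exists hη0
  have ev2 : ∀ᶠ η : ℝ in nhdsWithin 0 (Set.Ioi 0), ∀ z ∈ V,
      ∀ s : ℝ, s = x * (z.1 : ℝ) + y * (z.2 : ℝ) → ⌊s + ε⌋ = - ⌊-s + (1 - ε - η)⌋ := by
    rw [Filter.eventually_all_finite hf]
    intro z _
    have fp : 0 < 1 - Int.fract (x * (z.1 : ℝ) + y * (z.2 : ℝ) + ε) := by
      linarith [Int.fract_lt_one (x * (z.1 : ℝ) + y * (z.2 : ℝ) + ε)]
    filter_upwards [Ioo_mem_nhdsGT fp] with η hη s hs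
    obtain ⟨n0, n1⟩ := hη
    rw [← hs] at n1
    have q : ⌊-s + (1 - ε - η)⌋ = -⌊s + ε⌋ := by
      have e1 := Int.floor_le (s + ε)
      unfold Int.fract at n1
      rw [Int.floor_eq_iff]
      push_cast
      constructor <;> linarith
    rw [q, neg_neg]
  obtain ⟨η, hη, hη2⟩ := (ev.and ev2).exists
  set ε' := 1 - ε - η with hε'
  have iter : ∀ k : ℕ, ∀ a b : ℤ, (a, b) ∈ V →
      (tau2 (x, y) ε')^[k] (-a, -b) = (0, 0) → (tau2 (x, y) ε)^[k] (a, b) = (0, 0) := by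
    intro k
    induction k with
    | zero => intro a b _ h; simpa using h
    | succ k ih =>
      intro a b hp h
      rw [Function.iterate_succ_apply] at h ⊢
      have key := hη2 (a, b) hp _ rfl
      simp only at key
      have e : -(x * (a : ℝ) + y * b) + ε' = x * ((-a : ℤ) : ℝ) + y * ((-b : ℤ) : ℝ) + ε' := by
        push_cast; ring
      rw [e] at key
      have t1 : tau2 (x, y) ε (a, b) = (b, -⌊x * (a : ℝ) + y * b + ε⌋) := rfl
      have t2 : tau2 (x, y) ε' (-a, -b) = (-b, - -⌊x * (a : ℝ) + y * b + ε⌋) := by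
        simp only [tau2]
        rw [key]
        simp
      rw [t1]
      rw [t2] at h
      have e1 := Int.floor_le (x * (a : ℝ) + y * b + ε)
      have e2 := Int.lt_floor_add_one (x * (a : ℝ) + y * b + ε)
      refine ih _ _ ?_ h
      · apply hV.2 _ _ _ hp <;> push_cast <;> linarith
  refine witness hV (fun p q hpq => ?_) a b
  obtain ⟨k, hk⟩ := witness hV (hR ε' hη) (-p) (-q)
  exact ⟨k, iter k p q hpq hk⟩

theorem stmt_6 (ε : ℝ) (hε0 : 0 ≤ ε) (hε1 : ε < 1) : Bset ε ⊆ SRS2 ε := by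
  rintro ⟨x, y⟩ h ⟨a, b⟩
  rcases h with ⟨e1, b1, b2, b3, b4⟩ | ⟨e1, b1, b2, b3, b4⟩
  · have hy : Hyp x y ε := ⟨hε0, e1, b1, b2, b3, b4⟩
    obtain ⟨V, -, hV, hR⟩ := V_exists hy
    exact witness hV (hR ε hy) a b
  · exact mirror e1 hε1 b1 b2 b3 b4 a b
end
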